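/- The function b is cyclic for S_b if and only if b is outer. -/

import Mathlib

open MeasureTheory Complex Filter Set Metric
open scoped ComplexConjugate

noncomputable section

/-- The circle group `ℝ / 2πℤ`, parametrizing the unit circle `𝕋`. -/
instance fact_two_pi_pos : Fact (0 < 2 * Real.pi) := ⟨by positivity⟩

abbrev Tc : Type := AddCircle (2 * Real.pi)

/-- Normalized Lebesgue measure on the circle. -/
def m : Measure Tc := AddCircle.haarAddCircle

instance : IsProbabilityMeasure m := by unfold m; infer_instance

/-- The point `e^{iθ}` of the unit circle corresponding to `θ ∈ ℝ/2πℤ`. -/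
def bd (θ : Tc) : ℂ := (AddCircle.toCircle θ : ℂ)

/-- The open unit disc. -/
abbrev uDisc : Set ℂ := Metric.ball (0 : ℂ) 1

/-- A function holomorphic on the open unit disc. -/
def HolDisc (f : ℂ → ℂ) : Prop := DifferentiableOn ℂ f uDisc

/-- `F` is the radial (a.e.) boundary function of `f`. -/
def IsBdry (f : ℂ → ℂ) (F : Tc → ℂ) : Prop :=
  ∀ᵐ θ ∂m, Tendsto (fun r : ℝ => f ((r : ℂ) * bd θ)) (nhdsWithin 1 (Set.Iio 1)) (nhds (F θ))

/-- Membership in the Hardy space `H^p` of the unit disc, `0 < p < ∞`. -/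
def MemHp (p : ℝ) (f : ℂ → ℂ) : Prop :=
  HolDisc f ∧ ∃ C : ℝ, ∀ r : ℝ, 0 ≤ r → r < 1 →
    (∫ θ : Tc, ‖f ((r : ℂ) * bd θ)‖ ^ p ∂m) ≤ C

/-- Membership in `H^∞`: bounded holomorphic functions on the disc. -/
def MemHinf (f : ℂ → ℂ) : Prop := HolDisc f ∧ ∃ C : ℝ, ∀ z ∈ uDisc, ‖f z‖ ≤ C

/-- Outer functions on the unit disc. -/
def OuterFn (f : ℂ → ℂ) : Prop :=
  HolDisc f ∧ ∃ (α : ℂ) (w : Tc → ℝ), ‖α‖ = 1 ∧ (∀ θ, 0 ≤ w θ) ∧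
    Integrable (fun θ => Real.log (w θ)) m ∧
    ∀ z ∈ uDisc,
      f z = α * Complex.exp (∫ θ : Tc, ((bd θ + z) / (bd θ - z)) * (Real.log (w θ) : ℂ) ∂m)

/-- Inner functions: `Θ` holomorphic bounded by one, with unimodular boundary values `Θs`. -/
def InnerFn (Θ : ℂ → ℂ) (Θs : Tc → ℂ) : Prop :=
  HolDisc Θ ∧ (∀ z ∈ uDisc, ‖Θ z‖ ≤ 1) ∧ IsBdry Θ Θs ∧ (∀ᵐ θ ∂m, ‖Θs θ‖ = 1)

/-- `L²(𝕋, m)`. -/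
abbrev L2 : Type := Lp ℂ 2 m

/-- The Hardy space `H²`, viewed inside `L²(𝕋)` as the functions whose negative
Fourier coefficients vanish. -/
def H2 : Set L2 := {F | ∀ n : ℤ, n < 0 → fourierCoeff (F : Tc → ℂ) n = 0}

/-- The Cauchy kernel `k_λ(z) = 1/(1 - conj(λ) z)`. -/
def ker (lam z : ℂ) : ℂ := (1 - conj lam * z)⁻¹

/-- Divergence of `Σ (1 - |λ_n|)` (for `λ_n` in the unit disc this is the negation of
the Blaschke condition). -/
def NotBlaschke (lam : ℕ → ℂ) : Prop := ¬ Summable (fun n => 1 - ‖lam n‖)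

/-- A bundle recording: a non-constant function `b` in the closed unit ball of `H^∞`
with `log(1 - |b|) ∈ L¹(𝕋)`, its Pythagorean mate `a` (outer, `a(0) > 0`,
`|a|² + |b|² = 1` a.e.), together with their boundary functions `bs`, `as'`. -/
structure BPair where
  b : ℂ → ℂ
  a : ℂ → ℂ
  bs : Tc → ℂ
  as' : Tc → ℂ
  b_hol : HolDisc b
  b_le_one : ∀ z ∈ uDisc, ‖b z‖ ≤ 1
  b_nonconst : ¬ ∃ c : ℂ, ∀ z ∈ uDisc, b z = c
  b_bdry : IsBdry b bs
  log_int : Integrable (fun θ => Real.log (1 - ‖bs θ‖)) m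
  a_outer : OuterFn a
  a_bdry : IsBdry a as'
  a0_pos : ∃ r : ℝ, 0 < r ∧ a 0 = (r : ℂ)
  pyth : ∀ᵐ θ ∂m, ‖as' θ‖ ^ 2 + ‖bs θ‖ ^ 2 = 1

/-- The defining relation of `H(b)`: `T_{conj b} F = T_{conj a} F⁺`, i.e. all nonnegative
Fourier coefficients of `conj(b)·F - conj(a)·F⁺` vanish, with `F, F⁺ ∈ H²`. -/
def HbMem (P : BPair) (F Fp : L2) : Prop :=
  F ∈ H2 ∧ Fp ∈ H2 ∧ ∀ n : ℤ, 0 ≤ n →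
    fourierCoeff (fun θ => conj (P.bs θ) * (F : Tc → ℂ) θ - conj (P.as' θ) * (Fp : Tc → ℂ) θ) n = 0

/-- The ambient Hilbert space `L² ×_2 L²` in which `H(b)` embeds isometrically via
`f ↦ (f, f⁺)`; its norm is `‖(F, F⁺)‖² = ‖F‖₂² + ‖F⁺‖₂²`, the `H(b)` norm. -/
abbrev HbP : Type := WithLp 2 (L2 × L2)

def fst2 (p : HbP) : L2 := ((WithLp.equiv 2 (L2 × L2)) p).1
def snd2 (p : HbP) : L2 := ((WithLp.equiv 2 (L2 × L2)) p).2

/-- The de Branges–Rovnyak space `H(b)`, as the set of pairs `(f, f⁺)`. -/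
def HbSet (P : BPair) : Set HbP := {p | HbMem P (fst2 p) (snd2 p)}

/-- `q` represents the element `φ · f` of `H(b)`, where `p` represents `f` and `φs` is a
boundary function: `q ∈ H(b)` and the first component of `q` is `φs` times that of `p`. -/
def MulRep (P : BPair) (φs : Tc → ℂ) (p q : HbP) : Prop :=
  q ∈ HbSet P ∧ (fst2 q : Tc → ℂ) =ᵐ[m] fun θ => φs θ * (fst2 p : Tc → ℂ) θ

/-- `Zf` is the family of elements `z^n·f`, `n ≥ 0`, of `H(b)`, where `p` represents `f`. -/
def ZFamily (P : BPair) (p : HbP) (Zf : ℕ → HbP) : Prop :=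
  ∀ n : ℕ, MulRep P (fun θ => (bd θ) ^ n) p (Zf n)

/-- `f` (represented by the pair `p`) is cyclic for `S_b`: the linear span of
`{z^n f : n ≥ 0}` is dense in `H(b)`. -/
def CyclicSb (P : BPair) (p : HbP) : Prop :=
  p ∈ HbSet P ∧ ∀ Zf : ℕ → HbP, ZFamily P p Zf →
    closure (↑(Submodule.span ℂ (Set.range Zf)) : Set HbP) = HbSet P

/-- `FK` is the family of elements `f·k_{λ_n}`, `n ≥ 0`, of `H(b)`. -/
def KFamily (P : BPair) (lam : ℕ → ℂ) (p : HbP) (FK : ℕ → HbP) : Prop :=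
  ∀ n : ℕ, MulRep P (fun θ => ker (lam n) (bd θ)) p (FK n)

/-- `C` is a bound for the norm of the shift `S_b` on `H(b)`. -/
def ShiftBound (P : BPair) (C : ℝ) : Prop :=
  0 ≤ C ∧ ∀ p q : HbP, p ∈ HbSet P → MulRep P (fun θ => bd θ) p q → ‖q‖ ≤ C * ‖p‖

/-- `N = ‖S_b‖`, the operator norm of the shift on `H(b)`. -/
def IsShiftNorm (P : BPair) (N : ℝ) : Prop :=
  ShiftBound P N ∧ ∀ C : ℝ, ShiftBound P C → N ≤ C

/-- `μ` is the Aleksandrov–Clark measure `μ_α` of `b`. -/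
def IsACMeasure (P : BPair) (α : ℂ) (μ : Measure Tc) : Prop :=
  IsFiniteMeasure μ ∧ ∀ z ∈ uDisc,
    (1 - ‖P.b z‖ ^ 2) / ‖1 - conj α * P.b z‖ ^ 2 = ∫ θ : Tc, (1 - ‖z‖ ^ 2) / ‖z - bd θ‖ ^ 2 ∂μ



/-! ### Basics on the circle -/

lemma hasSum_congr' {f g : ℕ → ℂ} {a : ℂ} (h : ∀ n, f n = g n) (hf : HasSum f a) : HasSum g a :=
  (funext h : f = g) ▸ hf

lemma m_eq : m = (AddCircle.haarAddCircle : Measure Tc) := rfl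

lemma bd_cont : Continuous bd := by
  unfold bd; exact continuous_subtype_val.comp AddCircle.continuous_toCircle

lemma bd_norm (θ : Tc) : ‖bd θ‖ = 1 := by unfold bd; exact Circle.norm_coe _

lemma bd_ne (θ : Tc) : bd θ ≠ 0 := by
  intro h; have := bd_norm θ; rw [h] at this; simp at this

lemma bd_fourier_one (θ : Tc) : bd θ = fourier 1 θ := by rw [fourier_one]; rfl

lemma bd_pow (n : ℕ) (θ : Tc) : bd θ ^ n = fourier (n : ℤ) θ := by
  induction n with
  | zero => simp
  | succ n ih =>
    rw [pow_succ, ih, bd_fourier_one, ← fourier_add]; rfl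

lemma fou_norm (n : ℤ) (θ : Tc) : ‖fourier n θ‖ = 1 := by
  rw [fourier_apply]; exact Circle.norm_coe _

lemma fou_conj (n : ℤ) (θ : Tc) : conj (fourier n θ) = fourier (-n) θ := by
  rw [fourier_neg]

lemma fc_def (F : Tc → ℂ) (n : ℤ) : fourierCoeff F n = ∫ θ, fourier (-n) θ * F θ ∂m := rfl

lemma integral_fourier (n : ℤ) : ∫ θ, fourier n θ ∂m = if n = 0 then (1:ℂ) else 0 := by
  have h := congrFun (fourierCoeff_fourier (T := 2 * Real.pi) n) 0
  rw [fc_def] at h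
  simp only [neg_zero, fourier_zero, one_mul] at h
  rw [h, Pi.single_apply]
  simp [eq_comm]

/-- Taylor coefficients at the origin. -/
def tc (φ : ℂ → ℂ) (n : ℕ) : ℂ := (n.factorial : ℂ)⁻¹ * iteratedDeriv n φ 0

lemma tc_hasSum {φ : ℂ → ℂ} (h : HolDisc φ) {z : ℂ} (hz : z ∈ uDisc) :
    HasSum (fun n => tc φ n * z ^ n) (φ z) := by
  have := Complex.hasSum_taylorSeries_on_ball h hz
  refine hasSum_congr' (fun n => ?_) this
  simp only [tc, sub_zero, smul_eq_mul]; ring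

lemma rbd_mem {r : ℝ} (h0 : 0 ≤ r) (h1 : r < 1) (θ : Tc) : (r : ℂ) * bd θ ∈ uDisc := by
  simp [bd_norm, abs_of_nonneg h0, h1]

lemma tc_zero {φ : ℂ → ℂ} : tc φ 0 = φ 0 := by simp [tc]

lemma tc_summable {φ : ℂ → ℂ} (h : HolDisc φ) {r : ℝ} (h0 : 0 ≤ r) (h1 : r < 1) :
    Summable (fun n => ‖tc φ n‖ * r ^ n) := by
  have := (tc_hasSum h (z := (r : ℂ)) (by simpa [abs_of_nonneg h0] using h1)).summable.norm
  simpa [abs_of_nonneg h0] using this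

lemma fc_dilate {φ : ℂ → ℂ} (h : HolDisc φ) {r : ℝ} (h0 : 0 ≤ r) (h1 : r < 1) (n : ℤ) :
    fourierCoeff (fun θ => φ ((r : ℂ) * bd θ)) n =
      if 0 ≤ n then tc φ n.toNat * (r : ℂ) ^ n.toNat else 0 := by
  have hF : ∀ k : ℕ, ∀ θ, fourier (-n) θ * (tc φ k * ((r : ℂ) * bd θ) ^ k)
      = (tc φ k * (r : ℂ) ^ k) * fourier ((k : ℤ) - n) θ := by
    intro k θ
    rw [mul_pow, bd_pow, sub_eq_neg_add, fourier_add]; ring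
  have hs := hasSum_integral_of_summable_integral_norm (μ := m)
    (F := fun (k : ℕ) θ => (tc φ k * (r : ℂ) ^ k) * fourier ((k : ℤ) - n) θ)
    (fun k => by
      refine Integrable.const_mul ?_ _
      exact (ContinuousMap.continuous _).integrable_of_hasCompactSupport
        (HasCompactSupport.of_compactSpace _)) (by
      simp only [norm_mul, fou_norm, mul_one, norm_pow]
      simpa [abs_of_nonneg h0] using tc_summable h h0 h1)
  have e1 : ∫ θ, ∑' k : ℕ, (tc φ k * (r : ℂ) ^ k) * fourier ((k : ℤ) - n) θ ∂m
      = fourierCoeff (fun θ => φ ((r : ℂ) * bd θ)) n := by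
    rw [fc_def]
    congr 1; ext θ
    simp_rw [← hF]
    exact ((tc_hasSum h (rbd_mem h0 h1 θ)).mul_left _).tsum_eq
  rw [e1] at hs
  refine hs.unique ?_
  simp_rw [integral_const_mul, integral_fourier]
  split_ifs with hn
  · have := hasSum_ite_eq n.toNat (tc φ n.toNat * (r : ℂ) ^ n.toNat)
    refine hasSum_congr' (fun k => ?_) this
    by_cases hk : k = n.toNat
    · subst hk; simp [hn]
    · have : (k : ℤ) - n ≠ 0 := by omega
      simp [hk, this]
  · refine hasSum_congr' (fun k => ?_) hasSum_zero
    have : (k : ℤ) - n ≠ 0 := by omega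
    simp [this]

lemma dilate_cont {φ : ℂ → ℂ} (h : HolDisc φ) {r : ℝ} (h0 : 0 ≤ r) (h1 : r < 1) :
    Continuous (fun θ : Tc => φ ((r : ℂ) * bd θ)) :=
  h.continuousOn.comp_continuous (continuous_const.mul bd_cont) (rbd_mem h0 h1)


/-! ### Boundary functions of bounded holomorphic functions -/

/-- The Fourier basis on `L2`. -/
def fB : HilbertBasis ℤ ℂ L2 := fourierBasis (T := 2 * Real.pi)

lemma fB_repr (F : L2) (n : ℤ) : fB.repr F n = fourierCoeff (F : Tc → ℂ) n :=
  fourierBasis_repr (T := 2 * Real.pi) F n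

lemma L2_ext {F G : L2}
    (h : ∀ n, fourierCoeff (F : Tc → ℂ) n = fourierCoeff (G : Tc → ℂ) n) : F = G := by
  apply fB.repr.injective
  ext n
  rw [fB_repr, fB_repr, h]

lemma L2_normsq (F : L2) : HasSum (fun n : ℤ => ‖fourierCoeff (F : Tc → ℂ) n‖ ^ 2) (‖F‖ ^ 2) := by
  have h := lp.hasSum_norm (p := 2) (by norm_num) (fB.repr F)
  simp only [LinearIsometryEquiv.norm_map, ENNReal.toReal_ofNat, Real.rpow_ofNat, fB_repr] at h
  exact h

lemma L2_of_coeff (c : ℤ → ℂ) (hc : Summable (fun n => ‖c n‖ ^ 2)) :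
    ∃ F : L2, ∀ n, fourierCoeff (F : Tc → ℂ) n = c n := by
  have hm : Memℓp c 2 := by
    apply memℓp_gen
    simpa using hc
  refine ⟨fB.repr.symm ⟨c, hm⟩, fun n => ?_⟩
  rw [← fB_repr, LinearIsometryEquiv.apply_symm_apply]

lemma memLp_of_bdd {f : Tc → ℂ} (hf : AEStronglyMeasurable f m) {M : ℝ} (hM : ∀ᵐ θ ∂m, ‖f θ‖ ≤ M) :
    MemLp f 2 m := MemLp.of_bound hf M hM

lemma fc_toLp {f : Tc → ℂ} (hf : MemLp f 2 m) (n : ℤ) :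
    fourierCoeff (hf.toLp f : Tc → ℂ) n = fourierCoeff f n :=
  congrFun (fourierCoeff_congr_ae hf.coeFn_toLp) n

lemma norm_toLp_le {f : Tc → ℂ} (hf : MemLp f 2 m) {M : ℝ} (h0 : 0 ≤ M)
    (hM : ∀ᵐ θ ∂m, ‖f θ‖ ≤ M) : ‖hf.toLp f‖ ≤ M := by
  rw [Lp.norm_toLp]
  refine ENNReal.toReal_le_of_le_ofReal h0 ?_
  refine (eLpNorm_le_of_ae_bound hM).trans ?_
  simp

/-- A sequence increasing to one. -/
def rr (k : ℕ) : ℝ := 1 - 1 / ((k : ℝ) + 2)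

lemma rr_nonneg (k : ℕ) : 0 ≤ rr k := by
  unfold rr
  have : 1 / ((k : ℝ) + 2) ≤ 1 := by rw [div_le_one (by positivity)]; linarith [k.cast_nonneg (α := ℝ)]
  linarith

lemma rr_lt (k : ℕ) : rr k < 1 := by
  unfold rr
  have : 0 < 1 / ((k : ℝ) + 2) := by positivity
  linarith

lemma rr_tendsto : Tendsto rr atTop (nhds 1) := by
  unfold rr
  have : Tendsto (fun k : ℕ => 1 / ((k : ℝ) + 2)) atTop (nhds 0) := by
    have h := (tendsto_const_div_atTop_nhds_zero_nat (1:ℝ)).comp (tendsto_add_atTop_nat 2)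
    refine h.congr fun k => ?_
    simp
  simpa using this.const_sub 1

lemma rr_tendsto' : Tendsto rr atTop (nhdsWithin 1 (Set.Iio 1)) :=
  tendsto_nhdsWithin_iff.mpr ⟨rr_tendsto, Eventually.of_forall rr_lt⟩

/-- Taylor coefficients extended by zero to the integers. -/
def tcz (φ : ℂ → ℂ) (n : ℤ) : ℂ := if 0 ≤ n then tc φ n.toNat else 0

lemma tcz_neg (φ : ℂ → ℂ) {n : ℤ} (h : n < 0) : tcz φ n = 0 := by simp [tcz, not_le.mpr h]

lemma tcz_nat (φ : ℂ → ℂ) (n : ℕ) : tcz φ n = tc φ n := by simp [tcz]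

lemma fc_dilate' {φ : ℂ → ℂ} (h : HolDisc φ) {r : ℝ} (h0 : 0 ≤ r) (h1 : r < 1) (n : ℤ) :
    fourierCoeff (fun θ => φ ((r : ℂ) * bd θ)) n = tcz φ n * (r : ℂ) ^ n.toNat := by
  rw [fc_dilate h h0 h1, tcz]; split_ifs <;> simp

theorem bdry_exists {φ : ℂ → ℂ} {M : ℝ} (h : HolDisc φ) (hM : ∀ z ∈ uDisc, ‖φ z‖ ≤ M) :
    ∃ Φ : L2, (∀ n, fourierCoeff (Φ : Tc → ℂ) n = tcz φ n) ∧ ‖Φ‖ ≤ M ∧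
      TendstoInMeasure m (fun k θ => φ ((rr k : ℂ) * bd θ)) atTop (Φ : Tc → ℂ) := by
  have hM0 : 0 ≤ M := (norm_nonneg _).trans (hM 0 (by simp))
  have hmem : ∀ k, MemLp (fun θ : Tc => φ ((rr k : ℂ) * bd θ)) 2 m := fun k =>
    memLp_of_bdd (dilate_cont h (rr_nonneg k) (rr_lt k)).aestronglyMeasurable
      (M := M) (Eventually.of_forall fun θ => hM _ (rbd_mem (rr_nonneg k) (rr_lt k) θ))
  have hnorm : ∀ k, ‖(hmem k).toLp _‖ ≤ M := fun k =>
    norm_toLp_le (hmem k) hM0 (Eventually.of_forall fun θ => hM _ (rbd_mem (rr_nonneg k) (rr_lt k) θ))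
  have hfc : ∀ k n, fourierCoeff ((hmem k).toLp _ : Tc → ℂ) n = tcz φ n * (rr k : ℂ) ^ n.toNat :=
    fun k n => by rw [fc_toLp, fc_dilate' h (rr_nonneg k) (rr_lt k)]
  have hpow : ∀ n : ℤ, Tendsto (fun k => (rr k : ℂ) ^ n.toNat) atTop (nhds 1) := fun n => by
    have h1 : Tendsto (fun k => (rr k : ℂ)) atTop (nhds ((1 : ℝ) : ℂ)) :=
      (Complex.continuous_ofReal.tendsto 1).comp rr_tendsto
    simpa using h1.pow n.toNat
  have hpart : ∀ s : Finset ℤ, ∑ n ∈ s, ‖tcz φ n‖ ^ 2 ≤ M ^ 2 := by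
    intro s
    have hl : Tendsto (fun k => ∑ n ∈ s, ‖tcz φ n * (rr k : ℂ) ^ n.toNat‖ ^ 2) atTop
        (nhds (∑ n ∈ s, ‖tcz φ n‖ ^ 2)) := by
      refine tendsto_finsetSum _ fun n _ => ?_
      simpa using (((hpow n).const_mul (tcz φ n)).norm).pow 2
    refine le_of_tendsto' hl fun k => ?_
    have := sum_le_hasSum s (fun n _ => by positivity) (L2_normsq ((hmem k).toLp _))
    simp_rw [hfc] at this
    exact this.trans (pow_le_pow_left₀ (norm_nonneg _) (hnorm k) 2)
  have hsum : Summable (fun n => ‖tcz φ n‖ ^ 2) :=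
    summable_of_sum_le (fun n => by positivity) hpart
  obtain ⟨Φ, hΦ⟩ := L2_of_coeff _ hsum
  refine ⟨Φ, hΦ, ?_, ?_⟩
  · have h1 := L2_normsq Φ
    simp_rw [hΦ] at h1
    have h2 := hasSum_le_of_sum_le h1 hpart
    exact (pow_le_pow_iff_left₀ (norm_nonneg _) hM0 two_ne_zero).mp h2
  · have hT : Tendsto (fun k => (hmem k).toLp _) atTop (nhds Φ) := by
      rw [tendsto_iff_norm_sub_tendsto_zero]
      have h2 : Tendsto (fun k => ‖(hmem k).toLp _ - Φ‖ ^ 2) atTop (nhds 0) := by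
        have e : ∀ k, ‖(hmem k).toLp _ - Φ‖ ^ 2
            = ∑' n : ℤ, ‖tcz φ n * ((rr k : ℂ) ^ n.toNat - 1)‖ ^ 2 := by
          intro k
          rw [← (L2_normsq ((hmem k).toLp _ - Φ)).tsum_eq]
          congr 1; ext n
          rw [← fB_repr, map_sub, lp.coeFn_sub, Pi.sub_apply, fB_repr, fB_repr, hfc, hΦ, mul_sub,
            mul_one]
        simp_rw [e]
        have := tendsto_tsum_of_dominated_convergence (𝓕 := atTop)
          (f := fun (k : ℕ) (n : ℤ) => ‖tcz φ n * ((rr k : ℂ) ^ n.toNat - 1)‖ ^ 2)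
          (g := fun _ => (0:ℝ)) (bound := fun n => ‖tcz φ n‖ ^ 2) hsum
          (fun n => by
            have := (((hpow n).sub_const 1).const_mul (tcz φ n)).norm.pow 2
            simpa using this)
          (Eventually.of_forall fun k n => by
            rw [norm_pow, norm_norm, norm_mul]
            have : ‖(rr k : ℂ) ^ n.toNat - 1‖ ≤ 1 := by
              rw [← Complex.ofReal_pow, ← Complex.ofReal_one, ← Complex.ofReal_sub,
                Complex.norm_real, Real.norm_eq_abs, abs_le]
              have h1 := pow_nonneg (rr_nonneg k) n.toNat
              have h2 := pow_le_one₀ (n := n.toNat) (rr_nonneg k) (rr_lt k).le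
              constructor <;> linarith
            gcongr
            exact mul_le_of_le_one_right (norm_nonneg _) this)
        simpa using this
      have h3 := h2.sqrt
      simpa using h3
    exact (tendstoInMeasure_of_tendsto_Lp hT).congr (fun k => (hmem k).coeFn_toLp)
      (EventuallyEq.refl _ _)

/-- Uniqueness: a function with radial limits agrees with the `L²` boundary function. -/
lemma bdry_unique {φ : ℂ → ℂ} {F : Tc → ℂ} {Φ : L2} (hb : IsBdry φ F)
    (hT : TendstoInMeasure m (fun k θ => φ ((rr k : ℂ) * bd θ)) atTop (Φ : Tc → ℂ)) :
    F =ᵐ[m] (Φ : Tc → ℂ) := by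
  obtain ⟨ns, hns, hae⟩ := hT.exists_seq_tendsto_ae
  filter_upwards [hb, hae] with θ h1 h2
  exact tendsto_nhds_unique ((h1.comp rr_tendsto').comp hns.tendsto_atTop) h2

/-- Bounded sequences in `L²` with convergent Fourier coefficients converge weakly. -/
lemma weak_conv {Φ : ℕ → L2} {Ψ : L2} {M : ℝ} (hM : ∀ k, ‖Φ k‖ ≤ M)
    (hc : ∀ n, Tendsto (fun k => fourierCoeff (Φ k : Tc → ℂ) n) atTop
      (nhds (fourierCoeff (Ψ : Tc → ℂ) n))) (Y : L2) :
    Tendsto (fun k => inner ℂ Y (Φ k)) atTop (nhds (inner ℂ Y Ψ)) := by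
  have hM0 : 0 ≤ M := (norm_nonneg _).trans (hM 0)
  have hspan : ∀ Z ∈ Submodule.span ℂ (Set.range fB),
      Tendsto (fun k => inner ℂ Z (Φ k)) atTop (nhds (inner ℂ Z Ψ)) := by
    intro Z hZ
    induction hZ using Submodule.span_induction with
    | mem x hx =>
      obtain ⟨n, rfl⟩ := hx
      simp_rw [← fB.repr_apply_apply, fB_repr]
      exact hc n
    | zero => simp
    | add x y _ _ hx hy => simp_rw [inner_add_left]; exact hx.add hy
    | smul a x _ hx => simp_rw [inner_smul_left]; exact hx.const_mul _
  have hY : Y ∈ closure (Submodule.span ℂ (Set.range fB) : Set L2) := by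
    rw [← Submodule.topologicalClosure_coe, fB.dense_span]; trivial
  rw [Metric.tendsto_atTop]
  intro ε hε
  obtain ⟨Z, hZ, hYZ⟩ := Metric.mem_closure_iff.mp hY (ε / (2 * (M + ‖Ψ‖ + 1))) (by positivity)
  obtain ⟨N, hN⟩ := Metric.tendsto_atTop.mp (hspan Z hZ) (ε / 2) (by positivity)
  refine ⟨N, fun k hk => ?_⟩
  have h1 := hN k hk
  rw [dist_eq_norm] at h1 hYZ ⊢
  have e : inner ℂ Y (Φ k) - inner ℂ Y Ψ
      = inner ℂ (Y - Z) (Φ k - Ψ) + (inner ℂ Z (Φ k) - inner ℂ Z Ψ) := by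
    simp only [inner_sub_left, inner_sub_right]; ring
  rw [e]
  refine (norm_add_le _ _).trans_lt ?_
  have h2 : ‖inner ℂ (Y - Z) (Φ k - Ψ)‖ ≤ ε / 2 := by
    refine (norm_inner_le_norm _ _).trans ?_
    have h3 : ‖Φ k - Ψ‖ ≤ M + ‖Ψ‖ + 1 := by
      have := norm_sub_le (Φ k) Ψ
      have := hM k
      linarith
    calc ‖Y - Z‖ * ‖Φ k - Ψ‖ ≤ (ε / (2 * (M + ‖Ψ‖ + 1))) * (M + ‖Ψ‖ + 1) := by gcongr
      _ = ε / 2 := by field_simp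
  linarith

/-- Bounded pointwise convergence on the disc implies convergence of Taylor coefficients. -/
lemma tcz_tendsto {φ : ℕ → ℂ → ℂ} {ψ : ℂ → ℂ} {M : ℝ} (h : ∀ k, HolDisc (φ k)) (hψ : HolDisc ψ)
    (hM : ∀ k, ∀ z ∈ uDisc, ‖φ k z‖ ≤ M)
    (hp : ∀ z ∈ uDisc, Tendsto (fun k => φ k z) atTop (nhds (ψ z))) (n : ℤ) :
    Tendsto (fun k => tcz (φ k) n) atTop (nhds (tcz ψ n)) := by
  have h0 : (0:ℝ) ≤ 1/2 := by norm_num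
  have h1 : (1/2 : ℝ) < 1 := by norm_num
  have hr : ∀ φ, HolDisc φ → tcz φ n = (∫ θ, fourier (-n) θ * φ (((1/2 : ℝ) : ℂ) * bd θ) ∂m)
      * (((1/2:ℝ) : ℂ) ^ n.toNat)⁻¹ := by
    intro φ hφ
    rw [← fc_def (fun θ => φ (((1/2 : ℝ) : ℂ) * bd θ)), fc_dilate' hφ h0 h1, mul_assoc,
      mul_inv_cancel₀ (pow_ne_zero _ (by norm_num)), mul_one]
  rw [hr ψ hψ]
  simp_rw [fun k => hr (φ k) (h k)]
  refine Tendsto.mul_const _ ?_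
  refine tendsto_integral_of_dominated_convergence (fun _ => M) (fun k => ?_)
    (integrable_const _) (fun k => Eventually.of_forall fun θ => ?_)
    (Eventually.of_forall fun θ => ?_)
  · exact ((ContinuousMap.continuous _).mul (dilate_cont (h k) h0 h1)).aestronglyMeasurable
  · rw [norm_mul, fou_norm, one_mul]; exact hM k _ (rbd_mem h0 h1 θ)
  · exact (hp _ (rbd_mem h0 h1 θ)).const_mul _


/-! ### Herglotz and Poisson integrals -/

/-- Herglotz kernel. -/
def Hk (z : ℂ) (θ : Tc) : ℂ := (bd θ + z) / (bd θ - z)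

/-- Herglotz integral. -/
def HH (u : Tc → ℝ) (z : ℂ) : ℂ := ∫ θ, Hk z θ * (u θ : ℂ) ∂m

/-- Poisson kernel. -/
def pk (z : ℂ) (θ : Tc) : ℝ := (Hk z θ).re

lemma bd_sub_ge (z : ℂ) (θ : Tc) : 1 - ‖z‖ ≤ ‖bd θ - z‖ := by
  have := norm_sub_norm_le (bd θ) z
  rwa [bd_norm] at this

lemma disc_norm {z : ℂ} (hz : z ∈ uDisc) : ‖z‖ < 1 := by simpa using hz

lemma bd_sub_ne {z : ℂ} (hz : z ∈ uDisc) (θ : Tc) : bd θ - z ≠ 0 := by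
  have h1 := bd_sub_ge z θ
  have h2 := disc_norm hz
  exact norm_pos_iff.mp (by linarith)

lemma Hk_cont {z : ℂ} (hz : z ∈ uDisc) : Continuous (Hk z) :=
  (bd_cont.add continuous_const).div (bd_cont.sub continuous_const) (bd_sub_ne hz)

lemma Hk_norm {z : ℂ} (hz : z ∈ uDisc) (θ : Tc) : ‖Hk z θ‖ ≤ 2 / (1 - ‖z‖) := by
  unfold Hk
  rw [norm_div]
  have h1 := bd_sub_ge z θ
  have h2 := disc_norm hz
  have h3 : ‖bd θ + z‖ ≤ 2 := by
    have := norm_add_le (bd θ) z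
    rw [bd_norm] at this; linarith
  have : 0 < 1 - ‖z‖ := by linarith
  gcongr

lemma Hk_int {z : ℂ} (hz : z ∈ uDisc) {U : Tc → ℂ} (hU : Integrable U m) :
    Integrable (fun θ => Hk z θ * U θ) m :=
  hU.bdd_mul (Hk_cont hz).aestronglyMeasurable (Eventually.of_forall (Hk_norm hz))

lemma pk_cont {z : ℂ} (hz : z ∈ uDisc) : Continuous (pk z) := Complex.continuous_re.comp (Hk_cont hz)

lemma pk_int {z : ℂ} (hz : z ∈ uDisc) {U : Tc → ℂ} (hU : Integrable U m) :
    Integrable (fun θ => (pk z θ : ℂ) * U θ) m :=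
  hU.bdd_mul (c := 2 / (1 - ‖z‖))
    (Complex.continuous_ofReal.comp (pk_cont hz)).aestronglyMeasurable
    (Eventually.of_forall fun θ => by
      rw [Complex.norm_real]; exact (Complex.abs_re_le_norm _).trans (Hk_norm hz θ))

lemma pk_int_real {z : ℂ} (hz : z ∈ uDisc) {u : Tc → ℝ} (hu : Integrable u m) :
    Integrable (fun θ => pk z θ * u θ) m :=
  hu.bdd_mul (c := 2 / (1 - ‖z‖)) (pk_cont hz).aestronglyMeasurable
    (Eventually.of_forall fun θ => (Complex.abs_re_le_norm _).trans (Hk_norm hz θ))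

lemma pk_eq (z : ℂ) (θ : Tc) : pk z θ = (1 - ‖z‖ ^ 2) / ‖bd θ - z‖ ^ 2 := by
  have h := congrFun (poissonKernel_eq_re_herglotzRieszKernel (c := 0) (w := z)) (bd θ)
  simp only [poissonKernel, Function.comp, herglotzRieszKernel, sub_zero, bd_norm, one_pow] at h
  exact h.symm

lemma pk_nonneg {z : ℂ} (hz : z ∈ uDisc) (θ : Tc) : 0 ≤ pk z θ := by
  rw [pk_eq]
  have h2 := disc_norm hz
  have : ‖z‖ ^ 2 ≤ 1 := pow_le_one₀ (norm_nonneg _) h2.le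
  exact div_nonneg (by linarith) (by positivity)

lemma circleAverage_eq (f : ℂ → ℂ) : Real.circleAverage f 0 1 = ∫ θ, f (bd θ) ∂m := by
  rw [m_eq, AddCircle.integral_haarAddCircle, Real.circleAverage,
    ← AddCircle.intervalIntegral_preimage (2 * Real.pi) 0]
  simp [bd, AddCircle.toCircle, circleMap]

lemma pk_pow {z : ℂ} (hz : z ∈ uDisc) (n : ℕ) : ∫ θ, (pk z θ : ℂ) * bd θ ^ n ∂m = z ^ n := by
  have hd : DiffContOnCl ℂ (fun z : ℂ => z ^ n) (ball 0 1) :=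
    (differentiable_id.pow n).diffContOnCl
  have := hd.circleAverage_re_herglotzRieszKernel_smul hz
  rw [circleAverage_eq] at this
  rw [← this]
  congr 1; ext θ
  simp [pk, Hk, herglotzRieszKernel]

lemma pk_one {z : ℂ} (hz : z ∈ uDisc) : ∫ θ, pk z θ ∂m = 1 := by
  have := pk_pow hz 0
  simp only [pow_zero, mul_one] at this
  rw [integral_complex_ofReal] at this
  exact_mod_cast this

lemma HH_re {u : Tc → ℝ} (hu : Integrable u m) {z : ℂ} (hz : z ∈ uDisc) :
    (HH u z).re = ∫ θ, pk z θ * u θ ∂m := by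
  unfold HH
  have h := integral_re (Hk_int hz (hu.ofReal (𝕜 := ℂ)))
  simp only [RCLike.re_to_complex] at h
  refine h.symm.trans ?_
  congr 1; ext θ
  simp [pk]

lemma HH_le {u : Tc → ℝ} (hu : Integrable u m) {M : ℝ} (hM : ∀ᵐ θ ∂m, u θ ≤ M) {z : ℂ}
    (hz : z ∈ uDisc) : (HH u z).re ≤ M := by
  rw [HH_re hu hz]
  calc ∫ θ, pk z θ * u θ ∂m ≤ ∫ θ, pk z θ * M ∂m := by
        refine integral_mono_ae (pk_int_real hz hu) (pk_int_real hz (integrable_const M)) ?_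
        filter_upwards [hM] with θ h
        exact mul_le_mul_of_nonneg_left h (pk_nonneg hz θ)
    _ = M := by rw [integral_mul_const, pk_one hz, one_mul]

lemma HH_add {u v : Tc → ℝ} (hu : Integrable u m) (hv : Integrable v m) {z : ℂ}
    (hz : z ∈ uDisc) : HH (fun θ => u θ + v θ) z = HH u z + HH v z := by
  unfold HH
  have hu' : Integrable (fun θ => (u θ : ℂ)) m := hu.ofReal
  have hv' : Integrable (fun θ => (v θ : ℂ)) m := hv.ofReal
  rw [← integral_add (Hk_int hz hu') (Hk_int hz hv')]
  congr 1; ext θ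
  simp; ring

lemma HH_hol {u : Tc → ℝ} (hu : Integrable u m) : HolDisc (HH u) := by
  intro w hw
  have hw1 := disc_norm hw
  set d := (1 - ‖w‖) / 2 with hd
  have hd0 : 0 < d := by rw [hd]; linarith
  have hx : ∀ x ∈ ball w d, ‖x‖ ≤ 1 - d := by
    intro x hx
    have h1 : ‖x - w‖ < d := by simpa [dist_eq_norm] using hx
    have h2 := norm_add_le (x - w) w
    rw [sub_add_cancel] at h2
    linarith
  have hxD : ∀ x ∈ ball w d, x ∈ uDisc := fun x hx' => by
    have := hx x hx'; simp; linarith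
  have hu' : Integrable (fun θ => (u θ : ℂ)) m := hu.ofReal
  have key := hasDerivAt_integral_of_dominated_loc_of_deriv_le (μ := m) (𝕜 := ℂ)
    (F := fun x θ => Hk x θ * (u θ : ℂ)) (x₀ := w) (s := ball w d)
    (F' := fun x θ => (2 * bd θ / (bd θ - x) ^ 2) * (u θ : ℂ))
    (bound := fun θ => (2 / d ^ 2) * ‖u θ‖)
    (ball_mem_nhds w hd0)
    (by
      filter_upwards [ball_mem_nhds w hd0] with x hx'
      exact (Hk_int (hxD x hx') hu').aestronglyMeasurable)
    (Hk_int hw hu')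
    (by
      refine AEStronglyMeasurable.mul ?_ hu'.aestronglyMeasurable
      refine Continuous.aestronglyMeasurable ?_
      exact (continuous_const.mul bd_cont).div ((bd_cont.sub continuous_const).pow 2)
        (fun θ => pow_ne_zero _ (bd_sub_ne hw θ)))
    (Eventually.of_forall fun θ x hx' => by
      rw [norm_mul, norm_div, norm_mul, norm_pow, bd_norm, Complex.norm_real]
      have h1 := bd_sub_ge x θ
      have h2 := hx x hx'
      have h3 : d ≤ ‖bd θ - x‖ := by linarith
      simp only [Complex.norm_ofNat, mul_one]
      gcongr)
    (hu.norm.const_mul _)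
    (Eventually.of_forall fun θ x hx' => by
      have h₁ := bd_sub_ne (hxD x hx') θ
      have h₃ := ((hasDerivAt_id' x).const_add (bd θ)).div
        ((hasDerivAt_id' x).const_sub (bd θ)) h₁
      have h₂ : HasDerivAt (fun x => Hk x θ) (2 * bd θ / (bd θ - x) ^ 2) x := by
        refine h₃.congr_deriv ?_
        congr 1; ring
      exact h₂.mul_const _)
  exact key.2.differentiableAt.differentiableWithinAt

/-- Poisson integral of a complex function. -/
def PI (U : Tc → ℂ) (z : ℂ) : ℂ := ∫ θ, (pk z θ : ℂ) * U θ ∂m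

lemma PI_ofReal {u : Tc → ℝ} (hu : Integrable u m) {z : ℂ} (hz : z ∈ uDisc) :
    PI (fun θ => (u θ : ℂ)) z = ((HH u z).re : ℂ) := by
  rw [HH_re hu hz, PI, ← integral_complex_ofReal]
  simp

lemma pk_symm (r : ℝ) (θ φ : Tc) : pk ((r : ℂ) * bd θ) φ = pk ((r : ℂ) * bd φ) θ := by
  rw [pk_eq, pk_eq]
  have : ‖bd φ - r * bd θ‖ = ‖bd θ - r * bd φ‖ := by
    rw [← Complex.norm_conj (bd θ - r * bd φ)]
    have h1 : ∀ x, conj (bd x) = (bd x)⁻¹ := fun x => by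
      rw [Complex.inv_def, Complex.normSq_eq_norm_sq, bd_norm]; simp
    have h2 : bd φ - r * bd θ = (bd φ * bd θ) * conj (bd θ - r * bd φ) := by
      simp only [map_sub, map_mul, h1, Complex.conj_ofReal]
      have := bd_ne φ
      have := bd_ne θ
      field_simp
    rw [h2, norm_mul, norm_mul, bd_norm, bd_norm]; simp
  simp [this, bd_norm]

lemma pk_joint_cont {r : ℝ} (h0 : 0 ≤ r) (h1 : r < 1) :
    Continuous (fun p : Tc × Tc => pk ((r : ℂ) * bd p.1) p.2) := by
  unfold pk Hk
  refine Complex.continuous_re.comp (Continuous.div ?_ ?_ ?_)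
  · exact (bd_cont.comp continuous_snd).add (continuous_const.mul (bd_cont.comp continuous_fst))
  · exact (bd_cont.comp continuous_snd).sub (continuous_const.mul (bd_cont.comp continuous_fst))
  · exact fun p => bd_sub_ne (rbd_mem h0 h1 _) _

lemma pk_joint_int {r : ℝ} (h0 : 0 ≤ r) (h1 : r < 1) {U : Tc → ℂ} (hU : Integrable U m) :
    Integrable (fun p : Tc × Tc => (pk ((r : ℂ) * bd p.1) p.2 : ℂ) * U p.2) (m.prod m) := by
  have hU2 : Integrable (fun p : Tc × Tc => U p.2) (m.prod m) := hU.comp_snd m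
  refine hU2.bdd_mul (c := 2 / (1 - r))
    (Complex.continuous_ofReal.comp (pk_joint_cont h0 h1)).aestronglyMeasurable
    (Eventually.of_forall fun p => ?_)
  rw [Complex.norm_real]
  refine (Complex.abs_re_le_norm _).trans ((Hk_norm (rbd_mem h0 h1 p.1) p.2).trans ?_)
  simp [bd_norm, abs_of_nonneg h0]

lemma PI_int {r : ℝ} (h0 : 0 ≤ r) (h1 : r < 1) {U : Tc → ℂ} (hU : Integrable U m) :
    Integrable (fun θ => PI U ((r : ℂ) * bd θ)) m :=
  (pk_joint_int h0 h1 hU).integral_prod_left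

lemma PI_contr {r : ℝ} (h0 : 0 ≤ r) (h1 : r < 1) {U : Tc → ℂ} (hU : Integrable U m) :
    ∫ θ, ‖PI U ((r : ℂ) * bd θ)‖ ∂m ≤ ∫ θ, ‖U θ‖ ∂m := by
  have hj := (pk_joint_int h0 h1 hU).norm
  calc ∫ θ, ‖PI U ((r : ℂ) * bd θ)‖ ∂m
      ≤ ∫ θ, ∫ φ, ‖(pk ((r : ℂ) * bd θ) φ : ℂ) * U φ‖ ∂m ∂m :=
        integral_mono (PI_int h0 h1 hU).norm hj.integral_prod_left
          (fun θ => norm_integral_le_integral_norm _)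
    _ = ∫ φ, ∫ θ, ‖(pk ((r : ℂ) * bd θ) φ : ℂ) * U φ‖ ∂m ∂m := integral_integral_swap hj
    _ = ∫ θ, ‖U θ‖ ∂m := by
        congr 1; ext φ
        simp_rw [norm_mul, pk_symm r _ φ, Complex.norm_real, Real.norm_eq_abs,
          abs_of_nonneg (pk_nonneg (rbd_mem h0 h1 φ) _)]
        rw [integral_mul_const, pk_one (rbd_mem h0 h1 φ), one_mul]

lemma PI_sub {U V : Tc → ℂ} (hU : Integrable U m) (hV : Integrable V m) {z : ℂ}
    (hz : z ∈ uDisc) : PI (fun θ => U θ - V θ) z = PI U z - PI V z := by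
  unfold PI
  rw [← integral_sub (pk_int hz hU) (pk_int hz hV)]
  congr 1; ext θ; ring

lemma PI_add {U V : Tc → ℂ} (hU : Integrable U m) (hV : Integrable V m) {z : ℂ}
    (hz : z ∈ uDisc) : PI (fun θ => U θ + V θ) z = PI U z + PI V z := by
  unfold PI
  rw [← integral_add (pk_int hz hU) (pk_int hz hV)]
  congr 1; ext θ; ring

/-- `L¹` convergence of Poisson integrals. -/
def PT (U : Tc → ℂ) : Prop :=
  Tendsto (fun k => ∫ θ, ‖PI U ((rr k : ℂ) * bd θ) - U θ‖ ∂m) atTop (nhds 0)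

lemma cont_int (f : C(Tc, ℂ)) : Integrable (fun θ => f θ) m :=
  (ContinuousMap.continuous f).integrable_of_hasCompactSupport
        (HasCompactSupport.of_compactSpace _)

lemma PT_approx {U : Tc → ℂ} (hU : Integrable U m)
    (h : ∀ ε > 0, ∃ V : Tc → ℂ, Integrable V m ∧ PT V ∧ ∫ θ, ‖U θ - V θ‖ ∂m ≤ ε) : PT U := by
  unfold PT
  rw [Metric.tendsto_atTop]
  intro ε hε
  obtain ⟨V, hV, hPV, hUV⟩ := h (ε / 4) (by positivity)
  obtain ⟨N, hN⟩ := Metric.tendsto_atTop.mp hPV (ε / 4) (by positivity)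
  refine ⟨N, fun k hk => ?_⟩
  have h0 := rr_nonneg k
  have h1 := rr_lt k
  have h2 := hN k hk
  rw [Real.dist_eq, sub_zero] at h2 ⊢
  have h2' := (le_abs_self _).trans_lt h2
  rw [abs_of_nonneg (integral_nonneg fun _ => norm_nonneg _)]
  have hW : Integrable (fun θ => U θ - V θ) m := hU.sub hV
  have h3 := PI_contr h0 h1 hW
  have i1 : Integrable (fun θ => ‖PI V ((rr k : ℂ) * bd θ) - V θ‖) m :=
    ((PI_int h0 h1 hV).sub hV).norm
  have i2 : Integrable (fun θ => ‖PI (fun θ => U θ - V θ) ((rr k : ℂ) * bd θ)‖) m :=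
    (PI_int h0 h1 hW).norm
  have i3 : Integrable (fun θ => ‖U θ - V θ‖) m := hW.norm
  have i4 : Integrable (fun θ => ‖PI (fun θ => U θ - V θ) ((rr k : ℂ) * bd θ)‖
      + ‖U θ - V θ‖) m := i2.add i3
  have h4 : ∫ θ, ‖PI U ((rr k : ℂ) * bd θ) - U θ‖ ∂m ≤
      ∫ θ, (‖PI V ((rr k : ℂ) * bd θ) - V θ‖ + (‖PI (fun θ => U θ - V θ) ((rr k : ℂ) * bd θ)‖
        + ‖U θ - V θ‖)) ∂m := by
    refine integral_mono ((PI_int h0 h1 hU).sub hU).norm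
      (i1.add i4) fun θ => ?_
    have e : PI U ((rr k : ℂ) * bd θ) - U θ = (PI V ((rr k : ℂ) * bd θ) - V θ)
        + (PI (fun θ => U θ - V θ) ((rr k : ℂ) * bd θ) - (U θ - V θ)) := by
      rw [PI_sub hU hV (rbd_mem h0 h1 θ)]; ring
    beta_reduce
    rw [e]
    exact (norm_add_le _ _).trans (by gcongr; exact norm_sub_le _ _)
  rw [integral_add i1 i4, integral_add i2 i3] at h4
  linarith

lemma pk_fourier {z : ℂ} (hz : z ∈ uDisc) (n : ℤ) :
    PI (fun θ => fourier n θ) z = if 0 ≤ n then z ^ n.toNat else conj z ^ (-n).toNat := by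
  unfold PI
  split_ifs with hn
  · lift n to ℕ using hn
    simp_rw [← bd_pow]
    exact pk_pow hz n
  · obtain ⟨k, rfl⟩ : ∃ k : ℕ, n = -(k : ℤ) := ⟨(-n).toNat, by omega⟩
    have := congrArg conj (pk_pow hz k)
    rw [← integral_conj, map_pow] at this
    simp only [map_mul, Complex.conj_ofReal, bd_pow, fou_conj] at this
    simpa using this

lemma PT_fourier (n : ℤ) : PT (fun θ => fourier n θ) := by
  unfold PT
  have e : ∀ k, ∫ θ, ‖PI (fun θ => fourier n θ) ((rr k : ℂ) * bd θ) - fourier n θ‖ ∂m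
      = ‖(rr k : ℂ) ^ n.natAbs - 1‖ := by
    intro k
    have : ∀ θ, ‖PI (fun θ => fourier n θ) ((rr k : ℂ) * bd θ) - fourier n θ‖
        = ‖(rr k : ℂ) ^ n.natAbs - 1‖ := by
      intro θ
      have : PI (fun θ => fourier n θ) ((rr k : ℂ) * bd θ) = (rr k : ℂ) ^ n.natAbs * fourier n θ := by
        rw [pk_fourier (rbd_mem (rr_nonneg k) (rr_lt k) θ)]
        split_ifs with hn
        · lift n to ℕ using hn
          simp [mul_pow, bd_pow]
        · obtain ⟨j, rfl⟩ : ∃ k : ℕ, n = -(k : ℤ) := ⟨(-n).toNat, by omega⟩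
          rw [← map_pow, mul_pow, map_mul]
          simp only [neg_neg, Int.toNat_natCast, bd_pow, fou_conj, Int.natAbs_neg, Int.natAbs_natCast]
          simp
      rw [this, ← sub_one_mul, norm_mul, fou_norm, mul_one]
    simp_rw [this]
    simp
  simp_rw [e]
  have h1 : Tendsto (fun k => (rr k : ℂ)) atTop (nhds ((1 : ℝ) : ℂ)) :=
      (Complex.continuous_ofReal.tendsto 1).comp rr_tendsto
  simpa using ((h1.pow n.natAbs).sub_const 1).norm

lemma PT_span (f : C(Tc, ℂ)) (hf : f ∈ Submodule.span ℂ (Set.range (@fourier (2 * Real.pi)))) :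
    PT (fun θ => f θ) := by
  induction hf using Submodule.span_induction with
  | mem x hx => obtain ⟨n, rfl⟩ := hx; exact PT_fourier n
  | zero => simp [PT, PI]
  | add x y _ _ hx hy =>
    unfold PT at *
    have := hx.add hy
    rw [add_zero] at this
    refine squeeze_zero (fun _ => integral_nonneg fun _ => norm_nonneg _) (fun k => ?_) this
    have h0 := rr_nonneg k
    have h1 := rr_lt k
    have i1 : Integrable (fun θ => ‖PI (fun θ => x θ) ((rr k : ℂ) * bd θ) - x θ‖) m :=
      ((PI_int h0 h1 (cont_int x)).sub (cont_int x)).norm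
    have i2 : Integrable (fun θ => ‖PI (fun θ => y θ) ((rr k : ℂ) * bd θ) - y θ‖) m :=
      ((PI_int h0 h1 (cont_int y)).sub (cont_int y)).norm
    have i3 := ((PI_int h0 h1 (cont_int (x + y))).sub (cont_int (x + y))).norm
    rw [← integral_add i1 i2]
    refine integral_mono i3 (i1.add i2) fun θ => ?_
    have : PI (fun θ => (x + y) θ) ((rr k : ℂ) * bd θ) = PI (fun θ => x θ) ((rr k : ℂ) * bd θ)
        + PI (fun θ => y θ) ((rr k : ℂ) * bd θ) :=
      PI_add (cont_int x) (cont_int y) (rbd_mem h0 h1 θ)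
    dsimp only [Pi.add_apply, Pi.sub_apply]
    rw [this, ContinuousMap.add_apply, add_sub_add_comm]
    exact norm_add_le _ _
  | smul a x _ hx =>
    unfold PT at *
    have := hx.const_mul ‖a‖
    rw [mul_zero] at this
    refine this.congr fun k => ?_
    rw [← integral_const_mul]
    congr 1; ext θ
    have : PI (fun θ => (a • x) θ) ((rr k : ℂ) * bd θ) = a * PI (fun θ => x θ) ((rr k : ℂ) * bd θ) := by
      unfold PI
      rw [← integral_const_mul]
      congr 1; ext θ
      simp; ring
    beta_reduce
    rw [this, ContinuousMap.smul_apply, smul_eq_mul, ← mul_sub, norm_mul]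

lemma PT_cont (f : C(Tc, ℂ)) : PT (fun θ => f θ) := by
  refine PT_approx (cont_int f) fun ε hε => ?_
  have hf : f ∈ closure (Submodule.span ℂ (Set.range (@fourier (2 * Real.pi))) : Set C(Tc, ℂ)) := by
    rw [← Submodule.topologicalClosure_coe, span_fourier_closure_eq_top]; trivial
  obtain ⟨g, hg, hfg⟩ := Metric.mem_closure_iff.mp hf ε hε
  refine ⟨fun θ => g θ, cont_int g, PT_span g hg, ?_⟩
  have : ∫ θ, ‖f θ - g θ‖ ∂m ≤ ∫ _θ : Tc, ε ∂m := by
    refine integral_mono ((cont_int f).sub (cont_int g)).norm (integrable_const _) fun θ => ?_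
    rw [dist_eq_norm] at hfg
    exact ((f - g).norm_coe_le_norm θ).trans hfg.le
  simpa using this

lemma PT_int {U : Tc → ℂ} (hU : Integrable U m) : PT U := by
  refine PT_approx hU fun ε hε => ?_
  obtain ⟨g, -, h1, hc, hi⟩ := hU.exists_hasCompactSupport_integral_sub_le hε
  exact ⟨g, hi, PT_cont ⟨g, hc⟩, h1⟩

lemma HH_measure {u : Tc → ℝ} (hu : Integrable u m) :
    TendstoInMeasure m (fun k θ => (HH u ((rr k : ℂ) * bd θ)).re) atTop u := by
  have hU : Integrable (fun θ => (u θ : ℂ)) m := hu.ofReal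
  have h := PT_int hU
  have e : ∀ k θ, ‖PI (fun θ => (u θ : ℂ)) ((rr k : ℂ) * bd θ) - u θ‖
      = ‖(HH u ((rr k : ℂ) * bd θ)).re - u θ‖ := fun k θ => by
    rw [PI_ofReal hu (rbd_mem (rr_nonneg k) (rr_lt k) θ), ← Complex.ofReal_sub, Complex.norm_real]
  unfold PT at h
  simp_rw [e] at h
  have hi : ∀ k, Integrable (fun θ => (HH u ((rr k : ℂ) * bd θ)).re) m := fun k => by
    have := (PI_int (rr_nonneg k) (rr_lt k) hU).re
    refine this.congr (Eventually.of_forall fun θ => ?_)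
    simp [PI_ofReal hu (rbd_mem (rr_nonneg k) (rr_lt k) θ)]
  refine tendstoInMeasure_of_tendsto_eLpNorm (p := 1) one_ne_zero
    (fun k => (hi k).aestronglyMeasurable) hu.aestronglyMeasurable ?_
  have e2 : ∀ k, eLpNorm ((fun θ => (HH u ((rr k : ℂ) * bd θ)).re) - u) 1 m
      = ENNReal.ofReal (∫ θ, ‖(HH u ((rr k : ℂ) * bd θ)).re - u θ‖ ∂m) := fun k => by
    rw [eLpNorm_one_eq_lintegral_enorm]
    exact (ofReal_integral_norm_eq_lintegral_enorm ((hi k).sub hu)).symm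
  simp_rw [e2]
  simpa using ENNReal.tendsto_ofReal h


/-! ### Bounded holomorphic functions and their boundary values -/

/-- `Φ` is the boundary function of the bounded holomorphic function `φ`. -/
structure BF (φ : ℂ → ℂ) (Φ : L2) : Prop where
  hol : HolDisc φ
  bdd : ∃ M : ℝ, ∀ z ∈ uDisc, ‖φ z‖ ≤ M
  co : ∀ n, fourierCoeff (Φ : Tc → ℂ) n = tcz φ n
  meas : TendstoInMeasure m (fun k θ => φ ((rr k : ℂ) * bd θ)) atTop (Φ : Tc → ℂ)

lemma BF_exists {φ : ℂ → ℂ} {M : ℝ} (h : HolDisc φ) (hM : ∀ z ∈ uDisc, ‖φ z‖ ≤ M) :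
    ∃ Φ : L2, BF φ Φ ∧ ‖Φ‖ ≤ M := by
  obtain ⟨Φ, h1, h2, h3⟩ := bdry_exists h hM
  exact ⟨Φ, ⟨h, ⟨M, hM⟩, h1, h3⟩, h2⟩

lemma BF_unique {φ : ℂ → ℂ} {Φ Φ' : L2} (h : BF φ Φ) (h' : BF φ Φ') : Φ = Φ' :=
  L2_ext fun n => by rw [h.co, h'.co]

lemma BF_norm {φ : ℂ → ℂ} {Φ : L2} (h : BF φ Φ) {M : ℝ} (hM : ∀ z ∈ uDisc, ‖φ z‖ ≤ M) :
    ‖Φ‖ ≤ M := by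
  obtain ⟨Φ', h1, h2⟩ := BF_exists h.hol hM
  rwa [BF_unique h h1]

lemma tcz_congr {φ ψ : ℂ → ℂ} (hφ : HolDisc φ) (hψ : HolDisc ψ) {M : ℝ}
    (hM : ∀ z ∈ uDisc, ‖φ z‖ ≤ M)
    (he : ∀ z ∈ uDisc, φ z = ψ z) (n : ℤ) : tcz φ n = tcz ψ n := by
  have := tcz_tendsto (φ := fun _ => φ) (fun _ => hφ) hψ (fun _ => hM)
    (fun z hz => by rw [he z hz]; exact tendsto_const_nhds) n
  exact tendsto_nhds_unique tendsto_const_nhds this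

lemma BF_congr {φ ψ : ℂ → ℂ} {Φ : L2} (h : BF φ Φ) (he : ∀ z ∈ uDisc, φ z = ψ z) : BF ψ Φ := by
  obtain ⟨M, hM⟩ := h.bdd
  have hψ : HolDisc ψ := h.hol.congr fun z hz => (he z hz).symm
  refine ⟨hψ, ⟨M, fun z hz => by rw [← he z hz]; exact hM z hz⟩, fun n => ?_, ?_⟩
  · rw [h.co, tcz_congr h.hol hψ hM he]
  · have e : (fun (k : ℕ) (θ : Tc) => ψ ((rr k : ℂ) * bd θ)) = fun k θ => φ ((rr k : ℂ) * bd θ) := by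
      ext k θ
      rw [he _ (rbd_mem (rr_nonneg k) (rr_lt k) θ)]
    rw [e]; exact h.meas

lemma BF_bdry {φ : ℂ → ℂ} {Φ : L2} (h : BF φ Φ) {F : Tc → ℂ} (hF : IsBdry φ F) :
    F =ᵐ[m] (Φ : Tc → ℂ) := bdry_unique hF h.meas

lemma meas_comp {E : Type*} [PseudoEMetricSpace E] {f : ℕ → Tc → E} {F : Tc → E} (h : TendstoInMeasure m f atTop F)
    {ns : ℕ → ℕ} (hns : StrictMono ns) : TendstoInMeasure m (fun k => f (ns k)) atTop F :=
  fun ε hε => (h ε hε).comp hns.tendsto_atTop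

lemma meas_two {E E' : Type*} [PseudoEMetricSpace E] [PseudoEMetricSpace E']
    {f : ℕ → Tc → E} {F : Tc → E} {g : ℕ → Tc → E'} {G : Tc → E'}
    (hf : TendstoInMeasure m f atTop F) (hg : TendstoInMeasure m g atTop G) :
    ∃ ns : ℕ → ℕ, StrictMono ns ∧ ∀ᵐ θ ∂m, Tendsto (fun k => f (ns k) θ) atTop (nhds (F θ)) ∧
      Tendsto (fun k => g (ns k) θ) atTop (nhds (G θ)) := by
  obtain ⟨n1, h1, a1⟩ := hf.exists_seq_tendsto_ae
  obtain ⟨n2, h2, a2⟩ := (meas_comp hg h1).exists_seq_tendsto_ae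
  refine ⟨n1 ∘ n2, h1.comp h2, ?_⟩
  filter_upwards [a1, a2] with θ b1 b2
  exact ⟨b1.comp h2.tendsto_atTop, b2⟩

lemma meas_three {E E' E'' : Type*} [PseudoEMetricSpace E] [PseudoEMetricSpace E']
    [PseudoEMetricSpace E'']
    {f : ℕ → Tc → E} {F : Tc → E} {g : ℕ → Tc → E'} {G : Tc → E'} {h : ℕ → Tc → E''} {H : Tc → E''}
    (hf : TendstoInMeasure m f atTop F) (hg : TendstoInMeasure m g atTop G)
    (hh : TendstoInMeasure m h atTop H) :
    ∃ ns : ℕ → ℕ, StrictMono ns ∧ ∀ᵐ θ ∂m, Tendsto (fun k => f (ns k) θ) atTop (nhds (F θ)) ∧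
      Tendsto (fun k => g (ns k) θ) atTop (nhds (G θ)) ∧
      Tendsto (fun k => h (ns k) θ) atTop (nhds (H θ)) := by
  obtain ⟨n1, h1, a1⟩ := meas_two hf hg
  obtain ⟨n2, h2, a2⟩ := (meas_comp hh h1).exists_seq_tendsto_ae
  refine ⟨n1 ∘ n2, h1.comp h2, ?_⟩
  filter_upwards [a1, a2] with θ b1 b2
  exact ⟨b1.1.comp h2.tendsto_atTop, b1.2.comp h2.tendsto_atTop, b2⟩

lemma BF_mul {φ ψ : ℂ → ℂ} {Φ Ψ X : L2} (h1 : BF φ Φ) (h2 : BF ψ Ψ)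
    (h3 : BF (fun z => φ z * ψ z) X) : (X : Tc → ℂ) =ᵐ[m] fun θ => Φ θ * Ψ θ := by
  obtain ⟨ns, -, h⟩ := meas_three h1.meas h2.meas h3.meas
  filter_upwards [h] with θ h
  exact tendsto_nhds_unique h.2.2 (h.1.mul h.2.1)

lemma BF_lin {φ ψ : ℂ → ℂ} {Φ Ψ X : L2} (h1 : BF φ Φ) (h2 : BF ψ Ψ) (c : ℂ)
    (h3 : BF (fun z => c * φ z + ψ z) X) : (X : Tc → ℂ) =ᵐ[m] fun θ => c * Φ θ + Ψ θ := by
  obtain ⟨ns, -, h⟩ := meas_three h1.meas h2.meas h3.meas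
  filter_upwards [h] with θ h
  exact tendsto_nhds_unique h.2.2 ((h.1.const_mul c).add h.2.1)

lemma BF_ae_bdd {φ : ℂ → ℂ} {Φ : L2} (h : BF φ Φ) {M : ℝ} (hM : ∀ z ∈ uDisc, ‖φ z‖ ≤ M) :
    ∀ᵐ θ ∂m, ‖Φ θ‖ ≤ M := by
  obtain ⟨ns, -, ha⟩ := h.meas.exists_seq_tendsto_ae
  filter_upwards [ha] with θ ha
  exact le_of_tendsto ha.norm (Eventually.of_forall fun k => hM _ (rbd_mem (rr_nonneg _) (rr_lt _) θ))

lemma pow_hol (k : ℕ) : HolDisc (fun z => z ^ k) := (differentiable_id.pow k).differentiableOn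

lemma pow_bdd (k : ℕ) : ∀ z ∈ uDisc, ‖z ^ k‖ ≤ 1 := fun z hz => by
  rw [norm_pow]; exact pow_le_one₀ (norm_nonneg _) (disc_norm hz).le

lemma pow_bdry (k : ℕ) : IsBdry (fun z => z ^ k) (fun θ => fourier (k : ℤ) θ) := by
  refine Eventually.of_forall fun θ => ?_
  have : Continuous (fun r : ℝ => ((r : ℂ) * bd θ) ^ k) := by fun_prop
  have h := this.tendsto 1
  simp only [Complex.ofReal_one, one_mul, bd_pow] at h
  exact h.mono_left nhdsWithin_le_nhds

/-- Boundary modulus of an exponential Herglotz integral. -/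
lemma BF_modulus {g : ℂ → ℂ} {Φ : L2} (h : BF g Φ) {u : Tc → ℝ} (hu : Integrable u m)
    (hg : ∀ z ∈ uDisc, ‖g z‖ = Real.exp (HH u z).re) : ∀ᵐ θ ∂m, ‖Φ θ‖ = Real.exp (u θ) := by
  obtain ⟨ns, -, h⟩ := meas_two h.meas (HH_measure hu)
  filter_upwards [h] with θ h
  refine tendsto_nhds_unique h.1.norm ?_
  refine ((Real.continuous_exp.tendsto _).comp h.2).congr fun k => ?_
  exact (hg _ (rbd_mem (rr_nonneg _) (rr_lt _) θ)).symm

/-- The same for radial limits. -/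
lemma bdry_modulus {g : ℂ → ℂ} {F : Tc → ℂ} (h : IsBdry g F) {u : Tc → ℝ} (hu : Integrable u m)
    (hg : ∀ z ∈ uDisc, ‖g z‖ = Real.exp (HH u z).re) : ∀ᵐ θ ∂m, ‖F θ‖ = Real.exp (u θ) := by
  obtain ⟨ns, hns, h'⟩ := (HH_measure hu).exists_seq_tendsto_ae
  filter_upwards [h, h'] with θ h h'
  refine tendsto_nhds_unique ((h.comp rr_tendsto').comp hns.tendsto_atTop).norm ?_
  refine ((Real.continuous_exp.tendsto _).comp h').congr fun k => ?_
  exact (hg _ (rbd_mem (rr_nonneg _) (rr_lt _) θ)).symm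

lemma L2_mul_int (Y F : L2) : Integrable (fun θ => Y θ * F θ) m :=
  (Lp.memLp Y).integrable_mul (Lp.memLp F)

lemma conj_mem (Y : L2) : MemLp (fun θ => conj (Y θ)) 2 m := (Lp.memLp Y).star

lemma weak_conv' {Φ : ℕ → L2} {Ψ : L2} {M : ℝ} (hM : ∀ k, ‖Φ k‖ ≤ M)
    (hc : ∀ n, Tendsto (fun k => fourierCoeff (Φ k : Tc → ℂ) n) atTop
      (nhds (fourierCoeff (Ψ : Tc → ℂ) n))) (Y : L2) :
    Tendsto (fun k => ∫ θ, Y θ * Φ k θ ∂m) atTop (nhds (∫ θ, Y θ * Ψ θ ∂m)) := by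
  have e : ∀ F : L2, inner ℂ ((conj_mem Y).toLp _) F = ∫ θ, Y θ * F θ ∂m := fun F => by
    rw [MeasureTheory.L2.inner_def]
    refine integral_congr_ae ?_
    filter_upwards [(conj_mem Y).coeFn_toLp] with θ h
    rw [h]
    simp [mul_comm]
  have := weak_conv hM hc ((conj_mem Y).toLp _)
  simp_rw [e] at this
  exact this

/-- `Y` annihilates the boundary function of `φ`. -/
def nn (Y : L2) (φ : ℂ → ℂ) : Prop := ∀ Φ : L2, BF φ Φ → ∫ θ, Y θ * Φ θ ∂m = 0

lemma nn_lim {Y : L2} {φ : ℕ → ℂ → ℂ} {ψ : ℂ → ℂ} {M : ℝ} (h : ∀ k, HolDisc (φ k))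
    (hM : ∀ k, ∀ z ∈ uDisc, ‖φ k z‖ ≤ M)
    (hp : ∀ z ∈ uDisc, Tendsto (fun k => φ k z) atTop (nhds (ψ z))) (hn : ∀ k, nn Y (φ k)) :
    nn Y ψ := by
  intro Ψ hΨ
  choose Φ hΦ hΦM using fun k => BF_exists (h k) (hM k)
  have hw := weak_conv' hΦM (Ψ := Ψ) (fun n => by
    simp_rw [fun k => (hΦ k).co, hΨ.co]
    exact tcz_tendsto h hΨ.hol hM hp n) Y
  refine tendsto_nhds_unique hw ?_
  simp_rw [fun k => hn k _ (hΦ k)]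
  exact tendsto_const_nhds

lemma nn_lin {Y : L2} {φ ψ : ℂ → ℂ} {M M' : ℝ} (c : ℂ) (h : HolDisc φ) (h' : HolDisc ψ)
    (hM : ∀ z ∈ uDisc, ‖φ z‖ ≤ M) (hM' : ∀ z ∈ uDisc, ‖ψ z‖ ≤ M') (hn : nn Y φ) (hn' : nn Y ψ) :
    nn Y (fun z => c * φ z + ψ z) := by
  intro X hX
  obtain ⟨Φ, hΦ, -⟩ := BF_exists h hM
  obtain ⟨Ψ, hΨ, -⟩ := BF_exists h' hM'
  have e := BF_lin hΦ hΨ c hX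
  have : ∫ θ, Y θ * X θ ∂m = ∫ θ, (c * (Y θ * Φ θ) + Y θ * Ψ θ) ∂m := by
    refine integral_congr_ae ?_
    filter_upwards [e] with θ e
    rw [e]; ring
  rw [this, integral_add ((L2_mul_int Y Φ).const_mul c) (L2_mul_int Y Ψ), integral_const_mul,
    hn Φ hΦ, hn' Ψ hΨ]
  simp

lemma nn_zero (Y : L2) : nn Y (fun _ => 0) := by
  intro X hX
  have := BF_bdry hX (F := fun _ => 0) (Eventually.of_forall fun θ => tendsto_const_nhds)
  have h2 : ∫ θ, Y θ * X θ ∂m = ∫ _θ : Tc, (0:ℂ) ∂m := by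
    refine integral_congr_ae ?_
    filter_upwards [this] with θ e
    rw [← e, mul_zero]
  simpa using h2

lemma nn_congr {Y : L2} {φ ψ : ℂ → ℂ} (h : nn Y φ) (he : ∀ z ∈ uDisc, φ z = ψ z) : nn Y ψ :=
  fun Φ hΦ => h Φ (BF_congr hΦ fun z hz => (he z hz).symm)


/-! ### Outer functions are cyclic for the shift -/

lemma nn_poly {Y : L2} {g : ℂ → ℂ} {M : ℝ} (hg : HolDisc g) (hM : ∀ z ∈ uDisc, ‖g z‖ ≤ M)
    (hY : ∀ k : ℕ, nn Y (fun z => z ^ k * g z)) (c : ℕ → ℂ) (n : ℕ) :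
    HolDisc (fun z => (∑ i ∈ Finset.range n, c i * z ^ i) * g z) ∧
    (∀ z ∈ uDisc, ‖(∑ i ∈ Finset.range n, c i * z ^ i) * g z‖
      ≤ (∑ i ∈ Finset.range n, ‖c i‖) * M) ∧
    nn Y (fun z => (∑ i ∈ Finset.range n, c i * z ^ i) * g z) := by
  have hM0 : 0 ≤ M := (norm_nonneg _).trans (hM 0 (by simp))
  have hb : ∀ n, ∀ z ∈ uDisc, ‖(∑ i ∈ Finset.range n, c i * z ^ i) * g z‖
      ≤ (∑ i ∈ Finset.range n, ‖c i‖) * M := by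
    intro n z hz
    rw [norm_mul]
    refine mul_le_mul ?_ (hM z hz) (norm_nonneg _) (Finset.sum_nonneg fun _ _ => norm_nonneg _)
    refine (norm_sum_le _ _).trans (Finset.sum_le_sum fun i _ => ?_)
    rw [norm_mul]
    exact mul_le_of_le_one_right (norm_nonneg _) (pow_bdd i z hz)
  have hh : ∀ n, HolDisc (fun z => (∑ i ∈ Finset.range n, c i * z ^ i) * g z) := by
    intro n
    refine DifferentiableOn.mul (Differentiable.differentiableOn ?_) hg
    fun_prop
  refine ⟨hh n, hb n, ?_⟩
  induction n with
  | zero => exact nn_congr (nn_zero Y) fun z _ => by simp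
  | succ n ih =>
    have h1 : HolDisc (fun z => z ^ n * g z) := (pow_hol n).mul hg
    have h2 : ∀ z ∈ uDisc, ‖z ^ n * g z‖ ≤ 1 * M := fun z hz => by
      rw [norm_mul]
      exact mul_le_mul (pow_bdd n z hz) (hM z hz) (norm_nonneg _) zero_le_one
    refine nn_congr (nn_lin (c n) h1 (hh n) h2 (hb n) (hY n) ih) fun z _ => ?_
    rw [Finset.sum_range_succ]; ring

lemma smul_disc {r : ℝ} (h0 : 0 ≤ r) (h1 : r < 1) {z : ℂ} (hz : z ∈ uDisc) : (r : ℂ) * z ∈ uDisc := by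
  have := disc_norm hz
  have h2 : ‖(r : ℂ) * z‖ < 1 := by
    rw [norm_mul, Complex.norm_real, Real.norm_eq_abs, abs_of_nonneg h0]
    nlinarith [norm_nonneg z]
  simpa using h2

lemma nn_dil {Y : L2} {g : ℂ → ℂ} {M : ℝ} (hg : HolDisc g) (hM : ∀ z ∈ uDisc, ‖g z‖ ≤ M)
    (hY : ∀ k : ℕ, nn Y (fun z => z ^ k * g z)) {h : ℂ → ℂ} (hh : HolDisc h) {r : ℝ}
    (h0 : 0 ≤ r) (h1 : r < 1) : nn Y (fun z => h ((r : ℂ) * z) * g z) := by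
  have hM0 : 0 ≤ M := (norm_nonneg _).trans (hM 0 (by simp))
  set c : ℕ → ℂ := fun i => tc h i * (r : ℂ) ^ i with hc
  have hs : Summable (fun i => ‖c i‖) := by
    simpa [hc, abs_of_nonneg h0] using tc_summable hh h0 h1
  have key := fun n => nn_poly hg hM hY c n
  refine nn_lim (M := (∑' i, ‖c i‖) * M) (fun n => (key n).1) (fun n z hz => ?_) (fun z hz => ?_)
    (fun n => (key n).2.2)
  · refine ((key n).2.1 z hz).trans (mul_le_mul_of_nonneg_right ?_ hM0)
    exact hs.sum_le_tsum _ fun _ _ => norm_nonneg _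
  · refine Tendsto.mul_const _ ?_
    have := (tc_hasSum hh (smul_disc h0 h1 hz)).tendsto_sum_nat
    refine this.congr fun n => Finset.sum_congr rfl fun i _ => ?_
    rw [hc, mul_pow, mul_assoc]

lemma nn_mulbdd {Y : L2} {g : ℂ → ℂ} {M : ℝ} (hg : HolDisc g) (hM : ∀ z ∈ uDisc, ‖g z‖ ≤ M)
    (hY : ∀ k : ℕ, nn Y (fun z => z ^ k * g z)) {h : ℂ → ℂ} (hh : HolDisc h) {K : ℝ}
    (hK : ∀ z ∈ uDisc, ‖h z‖ ≤ K) : nn Y (fun z => h z * g z) := by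
  have hK0 : 0 ≤ K := (norm_nonneg _).trans (hK 0 (by simp))
  refine nn_lim (φ := fun k z => h ((rr k : ℂ) * z) * g z) (M := K * M) (fun k => ?_)
    (fun k z hz => ?_) (fun z hz => ?_) (fun k => nn_dil hg hM hY hh (rr_nonneg k) (rr_lt k))
  · refine DifferentiableOn.mul ?_ hg
    exact hh.comp (differentiable_id.const_mul _).differentiableOn
      (fun z hz => smul_disc (rr_nonneg k) (rr_lt k) hz)
  · rw [norm_mul]
    exact mul_le_mul (hK _ (smul_disc (rr_nonneg k) (rr_lt k) hz)) (hM z hz) (norm_nonneg _) hK0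
  · refine Tendsto.mul_const _ ?_
    have hcz : ContinuousAt h z := hh.continuousOn.continuousAt (isOpen_ball.mem_nhds hz)
    refine hcz.tendsto.comp ?_
    have h1 : Tendsto (fun k => (rr k : ℂ)) atTop (nhds ((1 : ℝ) : ℂ)) :=
      (Complex.continuous_ofReal.tendsto 1).comp rr_tendsto
    simpa using h1.mul_const z

lemma exp_HH_hol {u : Tc → ℝ} (hu : Integrable u m) : HolDisc (fun z => Complex.exp (HH u z)) :=
  (HH_hol hu).cexp

lemma exp_HH_le {u : Tc → ℝ} (hu : Integrable u m) {M : ℝ} (hM : ∀ᵐ θ ∂m, u θ ≤ M) {z : ℂ}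
    (hz : z ∈ uDisc) : ‖Complex.exp (HH u z)‖ ≤ Real.exp M := by
  rw [Complex.norm_exp]
  exact Real.exp_le_exp.mpr (HH_le hu hM hz)

lemma outer_nn {Y : L2} {g : ℂ → ℂ} {α : ℂ} {u : Tc → ℝ} (hα : ‖α‖ = 1) (hu : Integrable u m)
    (hu0 : ∀ᵐ θ ∂m, u θ ≤ 0) (hg : ∀ z ∈ uDisc, g z = α * Complex.exp (HH u z))
    (hY : ∀ k : ℕ, nn Y (fun z => z ^ k * g z)) : ∫ θ, Y θ ∂m = 0 := by
  have hghol : HolDisc g := ((exp_HH_hol hu).const_mul α).congr hg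
  have hg1 : ∀ z ∈ uDisc, ‖g z‖ ≤ 1 := fun z hz => by
    rw [hg z hz, norm_mul, hα, one_mul]
    simpa using exp_HH_le hu hu0 hz
  have hv : ∀ k : ℕ, Integrable (fun θ => - max (u θ) (-(k : ℝ))) m := fun k =>
    (hu.sup (integrable_const _)).neg
  have hw : ∀ k : ℕ, Integrable (fun θ => - max (u θ) (-(k : ℝ)) + u θ) m := fun k => (hv k).add hu
  have hw0 : ∀ k : ℕ, ∀ θ, - max (u θ) (-(k : ℝ)) + u θ ≤ 0 := fun k θ => by
    have := le_max_left (u θ) (-(k : ℝ)); linarith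
  have key : ∀ k : ℕ, nn Y (fun z => α * Complex.exp (HH (fun θ => - max (u θ) (-(k : ℝ)) + u θ) z)) := by
    intro k
    refine nn_congr (nn_mulbdd hghol hg1 hY (exp_HH_hol (hv k)) (K := Real.exp k) fun z hz => ?_)
      fun z hz => ?_
    · refine exp_HH_le (hv k) (Eventually.of_forall fun θ => ?_) hz
      have := le_max_right (u θ) (-(k : ℝ)); linarith
    · rw [hg z hz, HH_add (hv k) hu hz, Complex.exp_add]; ring
  have hfin : nn Y (fun _ => α) := by
    refine nn_lim (M := 1) (fun k => (exp_HH_hol (hw k)).const_mul α) (fun k z hz => ?_)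
      (fun z hz => ?_) key
    · rw [norm_mul, hα, one_mul]
      simpa using exp_HH_le (hw k) (Eventually.of_forall (hw0 k)) hz
    · have h1 : Tendsto (fun k : ℕ => HH (fun θ => - max (u θ) (-(k : ℝ)) + u θ) z) atTop
          (nhds (∫ _θ : Tc, (0:ℂ) ∂m)) := by
        unfold HH
        refine tendsto_integral_of_dominated_convergence (fun θ => 2 / (1 - ‖z‖) * ‖u θ‖)
          (fun k => ?_) (hu.norm.const_mul _) (fun k => ?_) ?_
        · have hw' : Integrable (fun θ => ((- max (u θ) (-(k : ℝ)) + u θ : ℝ) : ℂ)) m := (hw k).ofReal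
          exact (Hk_int hz hw').aestronglyMeasurable
        · filter_upwards [hu0] with θ h0
          rw [norm_mul]
          refine mul_le_mul (Hk_norm hz θ) ?_ (norm_nonneg _)
            (div_nonneg zero_le_two (by linarith [disc_norm hz]))
          rw [Complex.norm_real, Real.norm_eq_abs, Real.norm_eq_abs, abs_of_nonpos (hw0 k θ),
            abs_of_nonpos h0]
          have : max (u θ) (-(k : ℝ)) ≤ 0 := max_le h0 (by simp)
          linarith
        · refine Eventually.of_forall fun θ => ?_
          obtain ⟨N, hN⟩ := exists_nat_ge (-(u θ))
          refine tendsto_const_nhds.congr' ?_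
          filter_upwards [eventually_ge_atTop N] with k hk
          have : (N : ℝ) ≤ k := by exact_mod_cast hk
          rw [max_eq_left (by linarith)]
          simp
      rw [integral_zero] at h1
      have h2 := ((Complex.continuous_exp.tendsto 0).comp h1).const_mul α
      simpa using h2
  obtain ⟨Φ, hΦ, -⟩ := BF_exists (φ := fun _ => α) (M := 1) (differentiableOn_const α)
    (fun _ _ => hα.le)
  have h1 := hfin Φ hΦ
  have h2 := BF_bdry hΦ (F := fun _ => α) (Eventually.of_forall fun θ => tendsto_const_nhds)
  have h3 : ∫ θ, Y θ * Φ θ ∂m = ∫ θ, Y θ * α ∂m := by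
    refine integral_congr_ae ?_
    filter_upwards [h2] with θ e
    rw [← e]
  rw [h3, integral_mul_const] at h1
  have hα0 : α ≠ 0 := fun h => by simp [h] at hα
  exact (mul_eq_zero.mp h1).resolve_right hα0

/-- Cyclicity of a bounded function on the circle, in scalar form. -/
def Cyc (Φ : Tc → ℂ) : Prop :=
  ∀ Y : L2, (∀ k : ℕ, ∫ θ, Y θ * (fourier (k : ℤ) θ * Φ θ) ∂m = 0) → ∫ θ, Y θ ∂m = 0

lemma BF_pow_mul {g : ℂ → ℂ} {Φ X : L2} (hΦ : BF g Φ) (k : ℕ)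
    (hX : BF (fun z => z ^ k * g z) X) :
    (X : Tc → ℂ) =ᵐ[m] fun θ => fourier (k : ℤ) θ * Φ θ := by
  obtain ⟨Z, hZ, -⟩ := BF_exists (pow_hol k) (pow_bdd k)
  have h1 := BF_bdry hZ (pow_bdry k)
  have h2 := BF_mul hZ hΦ hX
  filter_upwards [h1, h2] with θ h1 h2
  rw [h2, ← h1]

theorem outer_cyc {g : ℂ → ℂ} {α : ℂ} {u : Tc → ℝ} (hα : ‖α‖ = 1) (hu : Integrable u m)
    (hu0 : ∀ᵐ θ ∂m, u θ ≤ 0) (hg : ∀ z ∈ uDisc, g z = α * Complex.exp (HH u z))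
    {Φ : L2} (hΦ : BF g Φ) : Cyc Φ := by
  intro Y hY
  refine outer_nn hα hu hu0 hg fun k X hX => ?_
  rw [← hY k]
  refine integral_congr_ae ?_
  filter_upwards [BF_pow_mul hΦ k hX] with θ h
  rw [h]


/-! ### Kernels of co-analytic Toeplitz operators -/

lemma fc_conj (F : Tc → ℂ) (n : ℤ) :
    fourierCoeff (fun θ => conj (F θ)) n = conj (fourierCoeff F (-n)) := by
  rw [fc_def, fc_def, ← integral_conj]
  congr 1; ext θ
  rw [map_mul, fou_conj, neg_neg]

lemma fc_shift (F : Tc → ℂ) (k n : ℤ) :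
    fourierCoeff (fun θ => fourier k θ * F θ) n = fourierCoeff F (n - k) := by
  rw [fc_def, fc_def]
  congr 1; ext θ
  rw [← mul_assoc, ← fourier_add]
  congr 3; ring

lemma int_eq_fc (F : Tc → ℂ) (k : ℤ) : ∫ θ, fourier k θ * F θ ∂m = fourierCoeff F (-k) := by
  rw [fc_def, neg_neg]

lemma int_eq_fc0 (F : Tc → ℂ) : ∫ θ, F θ ∂m = fourierCoeff F 0 := by
  rw [fc_def]; simp

lemma fc_const (c : ℂ) (n : ℤ) : fourierCoeff (fun _ : Tc => c) n = if n = 0 then c else 0 := by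
  rw [fc_def, integral_mul_const, integral_fourier]
  simp

lemma mul_mem {A : Tc → ℂ} (hA : AEStronglyMeasurable A m) (hA1 : ∀ᵐ θ ∂m, ‖A θ‖ ≤ 1) (F : L2) :
    MemLp (fun θ => A θ * F θ) 2 m := by
  refine (Lp.memLp F).of_le (hA.mul (Lp.aestronglyMeasurable F)) ?_
  filter_upwards [hA1] with θ h
  rw [norm_mul]
  exact mul_le_of_le_one_left (norm_nonneg _) h

lemma fou_meas (n : ℤ) : AEStronglyMeasurable (fun θ : Tc => fourier n θ) m :=
  (ContinuousMap.continuous _).aestronglyMeasurable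

lemma fou_mem (n : ℤ) (F : L2) : MemLp (fun θ => fourier n θ * F θ) 2 m :=
  mul_mem (fou_meas n) (Eventually.of_forall fun θ => (fou_norm n θ).le) F

lemma conj_meas {A : Tc → ℂ} (hA : AEStronglyMeasurable A m) :
    AEStronglyMeasurable (fun θ => conj (A θ)) m := Complex.continuous_conj.comp_aestronglyMeasurable hA

/-- Injectivity of the co-analytic Toeplitz operator. -/
lemma Tinj {A : Tc → ℂ} (hC : Cyc A) {F : L2} (hF : F ∈ H2)
    (h : ∀ n : ℤ, 0 ≤ n → fourierCoeff (fun θ => conj (A θ) * F θ) n = 0) : F = 0 := by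
  have hz : ∀ n : ℤ, fourierCoeff (F : Tc → ℂ) n = 0 := by
    intro n
    rcases lt_or_ge n 0 with hn | hn
    · exact hF n hn
    have hm := fou_mem n ((conj_mem F).toLp _)
    have hY : ∀ᵐ θ ∂m, hm.toLp _ θ = fourier n θ * conj (F θ) := by
      filter_upwards [hm.coeFn_toLp, (conj_mem F).coeFn_toLp] with θ h1 h2
      rw [h1, h2]
    have := hC (hm.toLp _) (fun k => by
      have e : ∫ θ, hm.toLp _ θ * (fourier (k : ℤ) θ * A θ) ∂m
          = ∫ θ, fourier (n + k) θ * conj (conj (A θ) * F θ) ∂m := by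
        refine integral_congr_ae ?_
        filter_upwards [hY] with θ h
        rw [h, map_mul, Complex.conj_conj, fourier_add]; ring
      rw [e, int_eq_fc (fun θ => conj (conj (A θ) * F θ)),
        fc_conj (fun θ => conj (A θ) * F θ), neg_neg, h _ (by omega), map_zero])
    rw [integral_congr_ae hY, int_eq_fc (fun θ => conj (F θ)), fc_conj, neg_neg] at this
    exact (map_eq_zero _).mp this
  refine L2_ext fun n => ?_
  rw [hz, fourierCoeff_congr_ae (Lp.coeFn_zero ℂ 2 m)]
  have := fc_const 0 n
  simp only [ite_self] at this
  exact this.symm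

lemma hasSum_congrZ {f g : ℤ → ℂ} {s : ℂ} (h : ∀ n, f n = g n) (hg : HasSum g s) : HasSum f s := by
  rwa [funext h]

lemma inner_coeff (F G : L2) :
    HasSum (fun n => conj (fourierCoeff (F : Tc → ℂ) n) * fourierCoeff (G : Tc → ℂ) n)
      (inner ℂ F G) := by
  have h := lp.hasSum_inner (𝕜 := ℂ) (fB.repr F) (fB.repr G)
  rw [LinearIsometryEquiv.inner_map_map] at h
  refine hasSum_congrZ (fun n => ?_) h
  rw [fB_repr, fB_repr]
  simp [mul_comm]

lemma inner_int (F G : L2) : inner ℂ F G = ∫ θ, conj (F θ) * G θ ∂m := by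
  rw [MeasureTheory.L2.inner_def]
  congr 1; ext θ
  simp [mul_comm]

lemma Cyc_of_ker {b : ℂ → ℂ} {B : L2} (hB : BF b B)
    (hK : ∀ F : L2, F ∈ H2 → (∀ n : ℤ, 0 ≤ n → fourierCoeff (fun θ => conj (B θ) * F θ) n = 0) →
      F = 0) : Cyc B := by
  intro Y hY
  set Yc := (conj_mem Y).toLp _ with hYc
  have hYcae := (conj_mem Y).coeFn_toLp
  rw [← hYc] at hYcae
  obtain ⟨F, hF⟩ := L2_of_coeff (fun n => if 0 ≤ n then fourierCoeff (Yc : Tc → ℂ) n else 0) (by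
    refine (L2_normsq Yc).summable.of_nonneg_of_le (fun n => by positivity) fun n => ?_
    split_ifs
    · exact le_rfl
    · simp)
  have hF2 : F ∈ H2 := fun n hn => by rw [hF, if_neg (not_le.mpr hn)]
  have hD : ∀ n, 0 ≤ n → fourierCoeff ((Yc - F : L2) : Tc → ℂ) n = 0 := fun n hn => by
    rw [← fB_repr, map_sub]
    simp [fB_repr, hF, hn]
  have hF0 := hK F hF2 (fun n hn => by
    have hm := fou_mem n B
    have h0 : inner ℂ (hm.toLp _) (Yc - F) = 0 := by
      refine (inner_coeff _ _).unique (hasSum_congrZ (fun j => ?_) hasSum_zero)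
      rw [fc_toLp, fc_shift (B : Tc → ℂ), hB.co]
      rcases lt_or_ge j 0 with hj | hj
      · rw [tcz_neg _ (by omega)]; simp
      · rw [hD j hj]; simp
    have h1 : inner ℂ (hm.toLp _) Yc = 0 := by
      rw [inner_int]
      obtain ⟨k, rfl⟩ := Int.eq_ofNat_of_zero_le hn
      have h2 := congrArg conj (hY k)
      rw [← integral_conj, map_zero] at h2
      rw [← h2]
      refine integral_congr_ae ?_
      filter_upwards [hYcae, hm.coeFn_toLp] with θ e1 e2
      rw [e1, e2]
      simp only [map_mul]; ring
    rw [inner_sub_right, h1, zero_sub, neg_eq_zero, inner_int] at h0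
    rw [fc_def, ← h0]
    refine integral_congr_ae ?_
    filter_upwards [hm.coeFn_toLp] with θ e2
    rw [e2, map_mul, fou_conj]; ring)
  have h1 := hF 0
  rw [hF0, fourierCoeff_congr_ae (Lp.coeFn_zero ℂ 2 m), if_pos le_rfl,
    fourierCoeff_congr_ae hYcae, fc_conj] at h1
  have h2 := fc_const 0 0
  rw [if_pos rfl] at h2
  have h3 : conj (fourierCoeff (Y : Tc → ℂ) (-0)) = 0 := h1.symm.trans h2
  rw [neg_zero] at h3
  rw [int_eq_fc0]
  exact (map_eq_zero _).mp h3

lemma HH_zero (u : Tc → ℝ) : HH u 0 = ((∫ θ, u θ ∂m : ℝ) : ℂ) := by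
  unfold HH
  rw [← integral_complex_ofReal]
  congr 1; ext θ
  simp [Hk, div_self (bd_ne θ)]


/-! ### Functions with trivial co-analytic kernel are outer -/

/-- The truncated logarithm of the modulus. -/
def vt (B : L2) (k : ℕ) (θ : Tc) : ℝ := - Real.log (max ‖B θ‖ (Real.exp (-(k : ℝ))))

lemma vt_le (B : L2) (k : ℕ) (θ : Tc) : vt B k θ ≤ k := by
  have h := Real.log_le_log (Real.exp_pos _) (le_max_right ‖B θ‖ (Real.exp (-(k : ℝ))))
  rw [Real.log_exp] at h
  unfold vt; linarith

lemma vt_nonneg (B : L2) (k : ℕ) {θ : Tc} (h : ‖B θ‖ ≤ 1) : 0 ≤ vt B k θ := by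
  have h1 : max ‖B θ‖ (Real.exp (-(k : ℝ))) ≤ 1 := max_le h (Real.exp_le_one_iff.mpr (by simp))
  have := Real.log_nonpos ((norm_nonneg _).trans (le_max_left _ _)) h1
  unfold vt; linarith

lemma vt_mono (B : L2) (θ : Tc) : Monotone (fun k => vt B k θ) := by
  intro j k hjk
  have hjk' : (j : ℝ) ≤ k := by exact_mod_cast hjk
  unfold vt
  refine neg_le_neg (Real.log_le_log (lt_max_of_lt_right (Real.exp_pos _)) ?_)
  exact max_le_max le_rfl (Real.exp_le_exp.mpr (by linarith))

lemma vt_meas (B : L2) (k : ℕ) : AEMeasurable (vt B k) m := by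
  have := (Lp.aestronglyMeasurable B).norm.aemeasurable
  exact (Real.measurable_log.comp_aemeasurable (this.max aemeasurable_const)).neg

lemma vt_int (B : L2) (hB1 : ∀ᵐ θ ∂m, ‖B θ‖ ≤ 1) (k : ℕ) : Integrable (vt B k) m := by
  refine Integrable.of_bound (vt_meas B k).aestronglyMeasurable (k : ℝ) ?_
  filter_upwards [hB1] with θ h
  rw [Real.norm_eq_abs, abs_of_nonneg (vt_nonneg B k h)]
  exact vt_le B k θ

lemma vt_integral {b : ℂ → ℂ} {B : L2} (hB : BF b B) (hb1 : ∀ z ∈ uDisc, ‖b z‖ ≤ 1) (h0 : b 0 ≠ 0)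
    (k : ℕ) : ∫ θ, vt B k θ ∂m ≤ - Real.log ‖b 0‖ := by
  have hB1 := BF_ae_bdd hB hb1
  have hv := vt_int B hB1 k
  have hh := exp_HH_hol hv
  have hhb : ∀ z ∈ uDisc, ‖Complex.exp (HH (vt B k) z)‖ ≤ Real.exp k := fun z hz =>
    exp_HH_le hv (Eventually.of_forall (vt_le B k)) hz
  obtain ⟨H, hH, -⟩ := BF_exists hh hhb
  obtain ⟨X, hX, -⟩ := BF_exists (φ := fun z => b z * Complex.exp (HH (vt B k) z))
    (M := 1 * Real.exp k) (hB.hol.mul hh)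
    (fun z hz => by
      rw [norm_mul]
      exact mul_le_mul (hb1 z hz) (hhb z hz) (norm_nonneg _) zero_le_one)
  have hX1 : ∀ᵐ θ ∂m, ‖X θ‖ ≤ 1 := by
    filter_upwards [BF_mul hB hH hX, BF_modulus hH hv fun z _ => Complex.norm_exp _] with θ e1 e2
    rw [e1, norm_mul, e2, vt, Real.exp_neg, Real.exp_log (lt_max_of_lt_right (Real.exp_pos _)),
      ← div_eq_mul_inv]
    exact div_le_one_of_le₀ (le_max_left _ _) ((norm_nonneg _).trans (le_max_left _ _))
  have h1 : ‖∫ θ, X θ ∂m‖ ≤ 1 := by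
    have := norm_integral_le_of_norm_le_const hX1
    simpa using this
  rw [int_eq_fc0, hX.co] at h1
  have h2 : tcz (fun z => b z * Complex.exp (HH (vt B k) z)) 0 = b 0 * Complex.exp (HH (vt B k) 0) := by
    have := tcz_nat (fun z => b z * Complex.exp (HH (vt B k) z)) 0
    rw [tc_zero] at this
    exact_mod_cast this
  rw [h2, HH_zero, norm_mul, Complex.norm_exp, Complex.ofReal_re] at h1
  have hp : 0 < ‖b 0‖ := norm_pos_iff.mpr h0
  have h3 := Real.log_le_log (mul_pos hp (Real.exp_pos _)) h1
  rw [Real.log_mul hp.ne' (Real.exp_pos _).ne', Real.log_exp, Real.log_one] at h3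
  linarith

lemma log_integrable {b : ℂ → ℂ} {B : L2} (hB : BF b B) (hb1 : ∀ z ∈ uDisc, ‖b z‖ ≤ 1)
    (h0 : b 0 ≠ 0) : Integrable (fun θ => Real.log ‖B θ‖) m ∧ ∀ᵐ θ ∂m, B θ ≠ 0 := by
  have hB1 := BF_ae_bdd hB hb1
  have hms : ∀ k, AEMeasurable (fun θ => ENNReal.ofReal (vt B k θ)) m := fun k =>
    (vt_meas B k).ennreal_ofReal
  have hL : ∫⁻ θ, ⨆ k, ENNReal.ofReal (vt B k θ) ∂m ≤ ENNReal.ofReal (- Real.log ‖b 0‖) := by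
    rw [lintegral_iSup' hms (Eventually.of_forall fun θ j k hjk =>
      ENNReal.ofReal_le_ofReal (vt_mono B θ hjk))]
    refine iSup_le fun k => ?_
    rw [← ofReal_integral_eq_lintegral_ofReal (vt_int B hB1 k)
      (by filter_upwards [hB1] with θ h; exact vt_nonneg B k h)]
    exact ENNReal.ofReal_le_ofReal (vt_integral hB hb1 h0 k)
  have hfin := ae_lt_top' (AEMeasurable.iSup hms) (hL.trans_lt ENNReal.ofReal_lt_top).ne
  have hne : ∀ᵐ θ ∂m, B θ ≠ 0 := by
    filter_upwards [hfin] with θ h hz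
    have h1 : ∀ k : ℕ, (k : ENNReal) ≤ ⨆ k, ENNReal.ofReal (vt B k θ) := fun k => by
      refine le_trans (le_of_eq ?_) (le_iSup (fun k => ENNReal.ofReal (vt B k θ)) k)
      have : vt B k θ = k := by
        unfold vt
        rw [hz, norm_zero, max_eq_right (Real.exp_pos _).le, Real.log_exp, neg_neg]
      rw [this, ENNReal.ofReal_natCast]
    obtain ⟨k, hk⟩ := ENNReal.exists_nat_gt h.ne
    exact absurd (h1 k) (not_le.mpr hk)
  refine ⟨⟨?_, ?_⟩, hne⟩
  · exact (Real.measurable_log.comp_aemeasurable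
      (Lp.aestronglyMeasurable B).norm.aemeasurable).aestronglyMeasurable
  · refine lt_of_le_of_lt ?_ (hL.trans_lt ENNReal.ofReal_lt_top)
    refine lintegral_mono_ae ?_
    filter_upwards [hB1, hne] with θ h1 h2
    have hp : 0 < ‖B θ‖ := norm_pos_iff.mpr h2
    obtain ⟨k, hk⟩ := exists_nat_ge (- Real.log ‖B θ‖)
    refine le_trans (le_of_eq ?_) (le_iSup (fun k => ENNReal.ofReal (vt B k θ)) k)
    have hle : Real.exp (-(k : ℝ)) ≤ ‖B θ‖ := by
      rw [← Real.exp_log hp]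
      exact Real.exp_le_exp.mpr (by linarith)
    rw [vt, max_eq_left hle, ← ofReal_norm, Real.norm_eq_abs,
      abs_of_nonpos (Real.log_nonpos (norm_nonneg _) h1)]

lemma b0_ne {b : ℂ → ℂ} {B : L2} (hB : BF b B)
    (hK : ∀ F : L2, F ∈ H2 → (∀ n : ℤ, 0 ≤ n → fourierCoeff (fun θ => conj (B θ) * F θ) n = 0) →
      F = 0) : b 0 ≠ 0 := by
  intro h0
  have hm : MemLp (fun _ : Tc => (1 : ℂ)) 2 m := memLp_const 1
  have h1 : hm.toLp _ = 0 := hK _ (fun n hn => by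
      rw [fc_toLp, fc_const, if_neg hn.ne]) (fun n hn => by
      have e : (fun θ => conj (B θ) * hm.toLp _ θ) =ᵐ[m] fun θ => conj (B θ) := by
        filter_upwards [hm.coeFn_toLp] with θ h
        rw [h, mul_one]
      rw [fourierCoeff_congr_ae e, fc_conj, hB.co]
      rcases hn.lt_or_eq with hn | rfl
      · rw [tcz_neg _ (by omega), map_zero]
      · have := tcz_nat b 0
        rw [tc_zero, h0] at this
        rw [neg_zero]
        have h3 : tcz b 0 = 0 := by exact_mod_cast this
        rw [h3, map_zero])
  have h2 := fc_toLp hm 0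
  rw [h1, fourierCoeff_congr_ae (Lp.coeFn_zero ℂ 2 m), fc_const, if_pos rfl] at h2
  have h3 := fc_const 0 0
  rw [if_pos rfl] at h3
  exact zero_ne_one (h3.symm.trans h2)

theorem ker_outer {b : ℂ → ℂ} {B : L2} (hB : BF b B) (hb1 : ∀ z ∈ uDisc, ‖b z‖ ≤ 1)
    (hK : ∀ F : L2, F ∈ H2 → (∀ n : ℤ, 0 ≤ n → fourierCoeff (fun θ => conj (B θ) * F θ) n = 0) →
      F = 0) : OuterFn b := by
  have hB1 := BF_ae_bdd hB hb1
  have h0 := b0_ne hB hK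
  obtain ⟨hu, hne⟩ := log_integrable hB hb1 h0
  have hCB := Cyc_of_ker hB hK
  have hu0 : ∀ᵐ θ ∂m, Real.log ‖B θ‖ ≤ 0 := by
    filter_upwards [hB1] with θ h
    exact Real.log_nonpos (norm_nonneg _) h
  set g : ℂ → ℂ := fun z => Complex.exp (HH (fun θ => Real.log ‖B θ‖) z) with hg
  have hghol : HolDisc g := exp_HH_hol hu
  have hg1 : ∀ z ∈ uDisc, ‖g z‖ ≤ 1 := fun z hz => by simpa using exp_HH_le hu hu0 hz
  obtain ⟨G, hG, -⟩ := BF_exists hghol hg1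
  have hGB : ∀ᵐ θ ∂m, ‖G θ‖ = ‖B θ‖ := by
    filter_upwards [BF_modulus hG hu fun z _ => Complex.norm_exp _, hne] with θ h1 h2
    rw [h1, Real.exp_log (norm_pos_iff.mpr h2)]
  have hCG : Cyc G := outer_cyc (α := 1) norm_one hu hu0 (fun z _ => by rw [one_mul]) hG
  have hΘm : AEStronglyMeasurable (fun θ => B θ / G θ) m :=
    ((Lp.aestronglyMeasurable B).aemeasurable.div
      (Lp.aestronglyMeasurable G).aemeasurable).aestronglyMeasurable
  have hΘ1 : ∀ᵐ θ ∂m, ‖B θ / G θ‖ = 1 := by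
    filter_upwards [hGB, hne] with θ h1 h2
    rw [norm_div, h1, div_self (norm_ne_zero_iff.mpr h2)]
  have hΘ2 := memLp_of_bdd hΘm (M := 1) (hΘ1.mono fun θ h => h.le)
  set Θ := hΘ2.toLp _ with hΘ
  have hΘe : ∀ᵐ θ ∂m, Θ θ * G θ = B θ ∧ ‖Θ θ‖ = 1 ∧ conj (Θ θ) * B θ = G θ := by
    filter_upwards [hΘ2.coeFn_toLp, hΘ1, hGB, hne] with θ e1 e2 e3 e4
    have hG0 : G θ ≠ 0 := norm_ne_zero_iff.mp (by rw [e3]; exact norm_ne_zero_iff.mpr e4)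
    have a1 : Θ θ * G θ = B θ := by rw [e1, div_mul_cancel₀ _ hG0]
    have a2 : ‖Θ θ‖ = 1 := by rw [e1, e2]
    refine ⟨a1, a2, ?_⟩
    rw [← a1, ← mul_assoc, Complex.conj_mul', a2]; simp
  have hneg : ∀ n : ℤ, 0 < n → fourierCoeff (Θ : Tc → ℂ) (-n) = 0 := by
    intro n hn
    have hm := fou_mem n Θ
    have h1 := hCG (hm.toLp _) (fun k => by
      have e : ∫ θ, hm.toLp _ θ * (fourier (k : ℤ) θ * G θ) ∂m = ∫ θ, fourier (n + k) θ * B θ ∂m := by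
        refine integral_congr_ae ?_
        filter_upwards [hm.coeFn_toLp, hΘe] with θ e1 e2
        rw [e1, ← e2.1, fourier_add]; ring
      rw [e, int_eq_fc, hB.co, tcz_neg _ (by omega)])
    rwa [integral_congr_ae hm.coeFn_toLp, int_eq_fc] at h1
  have hpos : ∀ n : ℤ, 0 < n → fourierCoeff (Θ : Tc → ℂ) n = 0 := by
    intro n hn
    have hc := conj_mem Θ
    have hm := fou_mem n (hc.toLp _)
    have hY : ∀ᵐ θ ∂m, hm.toLp _ θ = fourier n θ * conj (Θ θ) := by
      filter_upwards [hm.coeFn_toLp, hc.coeFn_toLp] with θ h1 h2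
      rw [h1, h2]
    have h1 := hCB (hm.toLp _) (fun k => by
      have e : ∫ θ, hm.toLp _ θ * (fourier (k : ℤ) θ * B θ) ∂m = ∫ θ, fourier (n + k) θ * G θ ∂m := by
        refine integral_congr_ae ?_
        filter_upwards [hY, hΘe] with θ e1 e2
        rw [e1, ← e2.2.2, fourier_add]; ring
      rw [e, int_eq_fc, hG.co, tcz_neg _ (by omega)])
    rw [integral_congr_ae hY, int_eq_fc (fun θ => conj (Θ θ)), fc_conj, neg_neg] at h1
    exact (map_eq_zero _).mp h1
  set c := fourierCoeff (Θ : Tc → ℂ) 0 with hc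
  have hcm : MemLp (fun _ : Tc => c) 2 m := memLp_const c
  have hΘc : Θ = hcm.toLp _ := L2_ext fun n => by
    rw [fc_toLp hcm, fc_const]
    rcases lt_trichotomy n 0 with h | h | h
    · have := hneg (-n) (by omega)
      rw [neg_neg] at this
      rw [this, if_neg h.ne]
    · rw [h, if_pos rfl]
    · rw [hpos n h, if_neg h.ne']
  have hcae : ∀ᵐ θ ∂m, Θ θ = c := by
    rw [hΘc]; exact hcm.coeFn_toLp
  have hc1 : ‖c‖ = 1 := by
    obtain ⟨θ, h1, h2⟩ := (hcae.and hΘe).exists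
    rw [← h1]; exact h2.2.1
  have hBG : (B : Tc → ℂ) =ᵐ[m] fun θ => c * G θ := by
    filter_upwards [hcae, hΘe] with θ h1 h2
    rw [← h2.1, h1]
  have hco : ∀ n : ℕ, tc b n = c * tc g n := by
    intro n
    rw [← tcz_nat, ← tcz_nat, ← hB.co, ← hG.co, fourierCoeff_congr_ae hBG, fc_def, fc_def,
      ← integral_const_mul]
    congr 1; ext θ; ring
  refine ⟨hB.hol, c, fun θ => ‖B θ‖, hc1, fun θ => norm_nonneg _, hu, fun z hz => ?_⟩
  have s1 := tc_hasSum hB.hol hz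
  have s2 := (tc_hasSum hghol hz).mul_left c
  refine s1.unique (hasSum_congr' (fun n => ?_) s2)
  rw [hco, mul_assoc]


/-! ### The space `H(b)` as an orthogonal complement -/

/-- Multiplication by a monomial on `L²`. -/
def sh (n : ℤ) (F : L2) : L2 := (fou_mem n F).toLp _

lemma sh_ae (n : ℤ) (F : L2) : (sh n F : Tc → ℂ) =ᵐ[m] fun θ => fourier n θ * F θ :=
  (fou_mem n F).coeFn_toLp

lemma fc_sh (k : ℤ) (F : L2) (n : ℤ) :
    fourierCoeff (sh k F : Tc → ℂ) n = fourierCoeff (F : Tc → ℂ) (n - k) := by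
  rw [fourierCoeff_congr_ae (sh_ae k F), fc_shift]

lemma sh_sh (j k : ℤ) (F : L2) : sh j (sh k F) = sh (k + j) F :=
  L2_ext fun n => by rw [fc_sh, fc_sh, fc_sh]; congr 1; ring

lemma inner_sh (n : ℤ) (X F : L2) :
    inner ℂ (sh n X) F = fourierCoeff (fun θ => conj (X θ) * F θ) n := by
  rw [inner_int, fc_def]
  refine integral_congr_ae ?_
  filter_upwards [sh_ae n X] with θ h
  rw [h, map_mul, fou_conj]; ring

lemma inner_sh_sh (j n : ℤ) (X F : L2) :
    inner ℂ (sh j X) (sh n F) = fourierCoeff (fun θ => conj (X θ) * F θ) (j - n) := by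
  rw [inner_int, fc_def]
  refine integral_congr_ae ?_
  filter_upwards [sh_ae j X, sh_ae n F] with θ h1 h2
  rw [h1, h2, map_mul, fou_conj, show -(j - n) = -j + n by ring, fourier_add]; ring

lemma fc_inner (F : L2) (n : ℤ) : fourierCoeff (F : Tc → ℂ) n = inner ℂ (fB n) F := by
  rw [← fB_repr, HilbertBasis.repr_apply_apply]

lemma inner_fB (F : L2) (n : ℤ) : inner ℂ F (fB n) = conj (fourierCoeff (F : Tc → ℂ) n) := by
  rw [fc_inner, inner_conj_symm]

lemma fc_fB (j n : ℤ) : fourierCoeff (fB j : Tc → ℂ) n = if n = j then 1 else 0 := by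
  rw [fc_inner, orthonormal_iff_ite.mp fB.orthonormal]

lemma fc_add (F G : L2) (n : ℤ) : fourierCoeff ((F + G : L2) : Tc → ℂ) n
    = fourierCoeff (F : Tc → ℂ) n + fourierCoeff (G : Tc → ℂ) n := by
  rw [fc_inner, fc_inner, fc_inner, inner_add_right]

lemma fc_smul (c : ℂ) (F : L2) (n : ℤ) : fourierCoeff ((c • F : L2) : Tc → ℂ) n
    = c * fourierCoeff (F : Tc → ℂ) n := by
  rw [fc_inner, fc_inner, inner_smul_right]

/-- The Hardy space as a submodule. -/
def H2s : Submodule ℂ L2 where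
  carrier := H2
  zero_mem' := fun n _ => by rw [fc_inner, inner_zero_right]
  add_mem' := fun {x y} hx hy n hn => by rw [fc_add, hx n hn, hy n hn, add_zero]
  smul_mem' := fun c x hx n hn => by rw [fc_smul, hx n hn, mul_zero]

lemma fB_mem {n : ℤ} (hn : 0 ≤ n) : fB n ∈ H2s := fun j hj => by
  rw [fc_fB, if_neg (by omega)]

lemma sh_mem {n : ℤ} (hn : 0 ≤ n) {F : L2} (hF : F ∈ H2) : sh n F ∈ H2s := fun j hj => by
  rw [fc_sh]; exact hF _ (by omega)

lemma BF_mem {φ : ℂ → ℂ} {Φ : L2} (h : BF φ Φ) : Φ ∈ H2 := fun n hn => by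
  rw [h.co, tcz_neg _ hn]

lemma Tinj' {A : L2} (hC : Cyc A) {F : L2} (hF : F ∈ H2)
    (h : ∀ n : ℤ, 0 ≤ n → inner ℂ (sh n A) F = 0) : F = 0 :=
  Tinj hC hF fun n hn => by rw [← inner_sh]; exact h n hn

lemma H2_ext {F : L2} (hF : F ∈ H2) (h : ∀ n : ℤ, 0 ≤ n → inner ℂ (fB n) F = 0) : F = 0 := by
  refine L2_ext fun n => ?_
  rw [fc_inner, fc_inner, inner_zero_right]
  rcases lt_or_ge n 0 with hn | hn
  · rw [← fc_inner]; exact hF n hn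
  · exact h n hn

/-- Pairs. -/
def pr (F G : L2) : HbP := WithLp.toLp 2 (F, G)

lemma fst2_pr (F G : L2) : fst2 (pr F G) = F := rfl

lemma snd2_pr (F G : L2) : snd2 (pr F G) = G := rfl

lemma inner_HbP (p q : HbP) : inner ℂ p q = inner ℂ (fst2 p) (fst2 q) + inner ℂ (snd2 p) (snd2 q) :=
  WithLp.prod_inner_apply p q

lemma HbP_ext {p : HbP} (h1 : fst2 p = 0) (h2 : snd2 p = 0) : p = 0 := by
  have : inner ℂ p p = 0 := by rw [inner_HbP, h1, h2]; simp
  exact inner_self_eq_zero.mp this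

lemma HbMem_iff (P : BPair) {A B : L2} (hA : P.as' =ᵐ[m] (A : Tc → ℂ)) (hB : P.bs =ᵐ[m] (B : Tc → ℂ))
    (F G : L2) :
    HbMem P F G ↔ F ∈ H2 ∧ G ∈ H2 ∧ ∀ n : ℤ, 0 ≤ n → inner ℂ (sh n B) F = inner ℂ (sh n A) G := by
  unfold HbMem
  refine and_congr_right fun _ => and_congr_right fun _ => forall₂_congr fun n _ => ?_
  have e : (fun θ => conj (P.bs θ) * F θ - conj (P.as' θ) * G θ)
      =ᵐ[m] fun θ => conj (B θ) * F θ - conj (A θ) * G θ := by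
    filter_upwards [hA, hB] with θ h1 h2
    rw [h1, h2]
  have iA := L2_mul_int (sh (-n) G) ((conj_mem A).toLp _)
  have iB := L2_mul_int (sh (-n) F) ((conj_mem B).toLp _)
  have iA' : Integrable (fun θ => fourier (-n) θ * (conj (A θ) * G θ)) m := by
    refine iA.congr ?_
    filter_upwards [sh_ae (-n) G, (conj_mem A).coeFn_toLp] with θ h1 h2
    rw [h1, h2]; ring
  have iB' : Integrable (fun θ => fourier (-n) θ * (conj (B θ) * F θ)) m := by
    refine iB.congr ?_
    filter_upwards [sh_ae (-n) F, (conj_mem B).coeFn_toLp] with θ h1 h2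
    rw [h1, h2]; ring
  have e2 : fourierCoeff (fun θ => conj (B θ) * F θ - conj (A θ) * G θ) n
      = inner ℂ (sh n B) F - inner ℂ (sh n A) G := by
    rw [inner_sh, inner_sh, fc_def, fc_def, fc_def, ← integral_sub iB' iA']
    congr 1; ext θ; ring
  rw [fourierCoeff_congr_ae e, e2, sub_eq_zero]

/-- Test vectors cutting out `H(b)`. -/
def Sb (A B : L2) : Set HbP :=
  {v | (∃ n : ℤ, n < 0 ∧ v = pr (fB n) 0) ∨ (∃ n : ℤ, n < 0 ∧ v = pr 0 (fB n)) ∨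
    ∃ n : ℤ, 0 ≤ n ∧ v = pr (sh n B) (-sh n A)}

/-- `H(b)` as a closed submodule. -/
def Kb (A B : L2) : Submodule ℂ HbP := (Submodule.span ℂ (Sb A B))ᗮ

lemma mem_Kb {A B : L2} {p : HbP} : p ∈ Kb A B ↔ fst2 p ∈ H2 ∧ snd2 p ∈ H2 ∧
    ∀ n : ℤ, 0 ≤ n → inner ℂ (sh n B) (fst2 p) = inner ℂ (sh n A) (snd2 p) := by
  have h1 : p ∈ Kb A B ↔ ∀ v ∈ Sb A B, inner ℂ v p = 0 := by
    unfold Kb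
    rw [Submodule.mem_orthogonal]
    refine ⟨fun h v hv => h v (Submodule.subset_span hv), fun h v hv => ?_⟩
    induction hv using Submodule.span_induction with
    | mem x hx => exact h x hx
    | zero => exact inner_zero_left _
    | add x y _ _ hx hy => rw [inner_add_left, hx, hy, add_zero]
    | smul c x _ hx => rw [inner_smul_left, hx, mul_zero]
  rw [h1]
  constructor
  · intro h
    refine ⟨fun n hn => ?_, fun n hn => ?_, fun n hn => ?_⟩
    · have := h _ (Or.inl ⟨n, hn, rfl⟩)
      rw [inner_HbP, fst2_pr, snd2_pr, inner_zero_left, add_zero] at this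
      rw [fc_inner, this]
    · have := h _ (Or.inr (Or.inl ⟨n, hn, rfl⟩))
      rw [inner_HbP, fst2_pr, snd2_pr, inner_zero_left, zero_add] at this
      rw [fc_inner, this]
    · have := h _ (Or.inr (Or.inr ⟨n, hn, rfl⟩))
      rw [inner_HbP, fst2_pr, snd2_pr, inner_neg_left, ← sub_eq_add_neg, sub_eq_zero] at this
      exact this
  · rintro ⟨h1, h2, h3⟩ v (⟨n, hn, rfl⟩ | ⟨n, hn, rfl⟩ | ⟨n, hn, rfl⟩)
    · rw [inner_HbP, fst2_pr, snd2_pr, inner_zero_left, add_zero, ← fc_inner]; exact h1 n hn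
    · rw [inner_HbP, fst2_pr, snd2_pr, inner_zero_left, zero_add, ← fc_inner]; exact h2 n hn
    · rw [inner_HbP, fst2_pr, snd2_pr, inner_neg_left, ← sub_eq_add_neg, sub_eq_zero]; exact h3 n hn

lemma exists_shift {A B : L2} (hA : A ∈ H2) (hA0 : fourierCoeff (A : Tc → ℂ) 0 ≠ 0) {p : HbP}
    (hp : p ∈ Kb A B) : ∃ q ∈ Kb A B, fst2 q = sh 1 (fst2 p) := by
  obtain ⟨h1, h2, h3⟩ := mem_Kb.mp hp
  set d := inner ℂ (sh 0 B) (sh 1 (fst2 p)) - inner ℂ (sh 0 A) (sh 1 (snd2 p)) with hd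
  set c := d / conj (fourierCoeff (A : Tc → ℂ) 0) with hc
  refine ⟨pr (sh 1 (fst2 p)) (sh 1 (snd2 p) + c • fB 0), mem_Kb.mpr ⟨?_, ?_, ?_⟩, rfl⟩
  · exact sh_mem (by norm_num) h1
  · exact H2s.add_mem (sh_mem (by norm_num) h2) (H2s.smul_mem c (fB_mem le_rfl))
  · intro n hn
    rw [fst2_pr, snd2_pr, inner_add_right, inner_smul_right, inner_fB, fc_sh]
    rcases hn.lt_or_eq with hn | rfl
    · rw [hA (0 - n) (by omega), inner_sh_sh, inner_sh_sh, ← inner_sh, ← inner_sh,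
        h3 _ (by omega)]
      simp
    · have : conj (fourierCoeff (A : Tc → ℂ) 0) ≠ 0 := (map_ne_zero _).mpr hA0
      rw [sub_zero, hc, div_mul_cancel₀ _ this, hd]; ring

lemma exists_shifts {A B : L2} (hA : A ∈ H2) (hA0 : fourierCoeff (A : Tc → ℂ) 0 ≠ 0) {p : HbP}
    (hp : p ∈ Kb A B) (n : ℕ) : ∃ q ∈ Kb A B, fst2 q = sh n (fst2 p) := by
  induction n with
  | zero =>
    refine ⟨p, hp, L2_ext fun n => ?_⟩
    rw [fc_sh]; simp
  | succ n ih =>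
    obtain ⟨q, hq, e⟩ := ih
    obtain ⟨q', hq', e'⟩ := exists_shift hA hA0 hq
    refine ⟨q', hq', ?_⟩
    rw [e', e, sh_sh]; push_cast; rfl

/-- Orthogonality forces vanishing when both `a` and `b` are outer. -/
lemma ortho_zero {A B : L2} (hA : A ∈ H2) (hCA : Cyc A) (hCB : Cyc B)
    (hpy : ∀ᵐ θ ∂m, ‖A θ‖ ^ 2 + ‖B θ‖ ^ 2 = 1) {Z : ℕ → HbP} (hZ : ∀ n, Z n ∈ Kb A B)
    (hZ1 : ∀ n : ℕ, fst2 (Z n) = sh n B) {q : HbP} (hq : q ∈ Kb A B)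
    (ho : ∀ n, inner ℂ (Z n) q = 0) : q = 0 := by
  obtain ⟨h1, h2, h3⟩ := mem_Kb.mp hq
  have hA1 : ∀ᵐ θ ∂m, ‖A θ‖ ^ 2 ≤ 1 := by
    filter_upwards [hpy] with θ h; nlinarith [sq_nonneg ‖B θ‖]
  set R : ℕ → L2 := fun n => sh n A + snd2 (Z n) with hR
  have hRm : ∀ n, R n ∈ H2s := fun n =>
    H2s.add_mem (sh_mem (by omega) hA) ((mem_Kb.mp (hZ n)).2.1)
  have hRo : ∀ n, inner ℂ (R n) (snd2 q) = 0 := fun n => by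
    have := ho n
    rw [inner_HbP, hZ1, h3 _ (by omega)] at this
    rw [hR, inner_add_left, this]
  have iAA : ∀ X : L2, ∀ n : ℤ, Integrable (fun θ => fourier n θ * (conj (X θ) * X θ)) m :=
    fun X n => by
      refine (L2_mul_int (sh n X) ((conj_mem X).toLp _)).congr ?_
      filter_upwards [sh_ae n X, (conj_mem X).coeFn_toLp] with θ h1 h2
      rw [h1, h2]; ring
  have hTR : ∀ j n : ℕ, inner ℂ (sh j A) (R n) = if j = n then 1 else 0 := by
    intro j n
    have e1 := (mem_Kb.mp (hZ n)).2.2 j (by omega)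
    rw [hR, inner_add_right, ← e1, hZ1, inner_sh_sh, inner_sh_sh, fc_def, fc_def,
      ← integral_add (iAA A _) (iAA B _)]
    have e2 : ∫ θ, (fourier (-((j : ℤ) - n)) θ * (conj (A θ) * A θ)
        + fourier (-((j : ℤ) - n)) θ * (conj (B θ) * B θ)) ∂m
        = ∫ θ, fourier (-((j : ℤ) - n)) θ ∂m := by
      refine integral_congr_ae ?_
      filter_upwards [hpy] with θ h
      have h' : ((‖A θ‖ : ℂ)) ^ 2 + (‖B θ‖ : ℂ) ^ 2 = 1 := by exact_mod_cast h
      rw [← mul_add, Complex.conj_mul', Complex.conj_mul', h', mul_one]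
    rw [e2, integral_fourier]
    refine if_congr ?_ rfl rfl
    omega
  have hE : ∀ n : ℕ, fB (n : ℤ) = ∑ i ∈ Finset.range (n + 1),
      conj (fourierCoeff (A : Tc → ℂ) ((n : ℤ) - i)) • R i := by
    intro n
    rw [← sub_eq_zero]
    refine Tinj' hCA (H2s.sub_mem (fB_mem (by omega))
      (H2s.sum_mem fun i _ => H2s.smul_mem _ (hRm i))) fun j hj => ?_
    obtain ⟨j, rfl⟩ := Int.eq_ofNat_of_zero_le hj
    rw [inner_sub_right, inner_fB, fc_sh, inner_sum]
    simp_rw [inner_smul_right, hTR]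
    simp only [mul_ite, mul_one, mul_zero]
    rw [Finset.sum_ite_eq, sub_eq_zero]
    split_ifs with h
    · rfl
    · rw [hA _ (by rw [Finset.mem_range] at h; omega), map_zero]
  have hs0 : snd2 q = 0 := H2_ext h2 fun n hn => by
    obtain ⟨n, rfl⟩ := Int.eq_ofNat_of_zero_le hn
    rw [hE, sum_inner]
    refine Finset.sum_eq_zero fun i _ => ?_
    rw [inner_smul_left, hRo, mul_zero]
  refine HbP_ext (Tinj' hCB h1 fun n hn => ?_) hs0
  rw [h3 n hn, hs0, inner_zero_right]

lemma outer_BF {a : ℂ → ℂ} {F : Tc → ℂ} (ha : OuterFn a) (hF : IsBdry a F)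
    (hF1 : ∀ᵐ θ ∂m, ‖F θ‖ ≤ 1) : ∃ A : L2, BF a A ∧ F =ᵐ[m] (A : Tc → ℂ) ∧ Cyc A ∧
      ∀ᵐ θ ∂m, ‖A θ‖ ≤ 1 := by
  obtain ⟨hol, α, w, hα, -, hu, hz⟩ := ha
  have hz' : ∀ z ∈ uDisc, a z = α * Complex.exp (HH (fun θ => Real.log (w θ)) z) := hz
  have hmod : ∀ z ∈ uDisc, ‖a z‖ = Real.exp (HH (fun θ => Real.log (w θ)) z).re := fun z h => by
    rw [hz' z h, norm_mul, hα, one_mul, Complex.norm_exp]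
  have hu0 : ∀ᵐ θ ∂m, Real.log (w θ) ≤ 0 := by
    filter_upwards [bdry_modulus hF hu hmod, hF1] with θ h1 h2
    rw [h1] at h2
    exact Real.exp_le_one_iff.mp h2
  have ha1 : ∀ z ∈ uDisc, ‖a z‖ ≤ 1 := fun z h => by
    rw [hmod z h]
    exact Real.exp_le_one_iff.mpr (HH_le hu hu0 h)
  obtain ⟨A, hA, -⟩ := BF_exists hol ha1
  exact ⟨A, hA, BF_bdry hA hF, outer_cyc hα hu hu0 hz' hA, BF_ae_bdd hA ha1⟩

/-- The function `b` is cyclic for `S_b` if and only if `b` is outer. -/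
theorem stmt_13 (P : BPair) (pb : HbP) (hpb : pb ∈ HbSet P)
    (hbd : (fst2 pb : Tc → ℂ) =ᵐ[m] P.bs) :
    CyclicSb P pb ↔ OuterFn P.b := by
  have hp := P.pyth
  have ha1 : ∀ᵐ θ ∂m, ‖P.as' θ‖ ≤ 1 := by
    filter_upwards [hp] with θ h
    nlinarith [sq_nonneg ‖P.bs θ‖, norm_nonneg (P.as' θ)]
  have hbs1 : ∀ᵐ θ ∂m, ‖P.bs θ‖ ≤ 1 := by
    filter_upwards [hp] with θ h
    nlinarith [sq_nonneg ‖P.as' θ‖, norm_nonneg (P.bs θ)]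
  obtain ⟨A, hA, hAe, hCA, -⟩ := outer_BF P.a_outer P.a_bdry ha1
  obtain ⟨B, hB, -⟩ := BF_exists P.b_hol P.b_le_one
  have hBe := BF_bdry hB P.b_bdry
  have hpy : ∀ᵐ θ ∂m, ‖A θ‖ ^ 2 + ‖B θ‖ ^ 2 = 1 := by
    filter_upwards [hp, hAe, hBe] with θ h1 h2 h3
    rw [← h2, ← h3]; exact h1
  have hKb : ∀ p : HbP, p ∈ HbSet P ↔ p ∈ Kb A B := fun p => by
    rw [mem_Kb]
    exact HbMem_iff P hAe hBe _ _
  have hset : HbSet P = (Kb A B : Set HbP) := Set.ext hKb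
  have hpB : fst2 pb = B := Lp.ext (hbd.trans hBe)
  have hZfst : ∀ Zf : ℕ → HbP, ZFamily P pb Zf → ∀ n : ℕ, fst2 (Zf n) = sh n B := by
    intro Zf hZ n
    refine Lp.ext ?_
    filter_upwards [(hZ n).2, sh_ae n B] with θ h1 h2
    rw [h1, h2, hpB, bd_pow]
  have hA0 : fourierCoeff (A : Tc → ℂ) 0 ≠ 0 := by
    obtain ⟨r, hr, h0⟩ := P.a0_pos
    have h1 := tcz_nat P.a 0
    rw [tc_zero] at h1
    have h2 : tcz P.a 0 = P.a 0 := by exact_mod_cast h1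
    rw [hA.co, h2, h0]
    exact_mod_cast hr.ne'
  constructor
  · rintro ⟨-, hcyc⟩
    refine ker_outer hB P.b_le_one fun F hF hT => ?_
    choose Zf hZ hZ1 using exists_shifts (BF_mem hA) hA0 ((hKb pb).mp hpb)
    have hZF : ZFamily P pb Zf := fun n => by
      refine ⟨(hKb _).mpr (hZ n), ?_⟩
      rw [hZ1]
      filter_upwards [sh_ae n (fst2 pb)] with θ h
      rw [h, bd_pow]
    have hcl := hcyc Zf hZF
    have hmem : pr F 0 ∈ Kb A B := by
      rw [mem_Kb, fst2_pr, snd2_pr]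
      refine ⟨hF, H2s.zero_mem, fun n hn => ?_⟩
      rw [inner_sh, hT n hn, inner_zero_right]
    have h1 : pr F 0 ∈ (Submodule.span ℂ (Set.range Zf)).topologicalClosure := by
      have : pr F 0 ∈ closure (↑(Submodule.span ℂ (Set.range Zf)) : Set HbP) := by
        rw [hcl, hKb]; exact hmem
      exact this
    have h2 : pr F 0 ∈ (Submodule.span ℂ (Set.range Zf))ᗮ := by
      rw [Submodule.mem_orthogonal]
      intro v hv
      induction hv using Submodule.span_induction with
      | mem x hx =>
        obtain ⟨n, rfl⟩ := hx
        rw [inner_HbP, hZ1, hpB, fst2_pr, snd2_pr, inner_zero_right, add_zero, inner_sh,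
          hT _ (by omega)]
      | zero => exact inner_zero_left _
      | add x y _ _ hx hy => rw [inner_add_left, hx, hy, add_zero]
      | smul c x _ hx => rw [inner_smul_left, hx, mul_zero]
    rw [← Submodule.orthogonal_closure] at h2
    have h3 : inner ℂ (pr F 0) (pr F 0) = 0 := (Submodule.mem_orthogonal _ _).mp h2 _ h1
    rw [inner_self_eq_zero] at h3
    have h4 := congrArg fst2 h3
    rw [fst2_pr] at h4
    exact h4
  · intro hout
    obtain ⟨B', hB', -, hCB, -⟩ := outer_BF hout P.b_bdry hbs1
    rw [BF_unique hB' hB] at hCB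
    refine ⟨hpb, fun Zf hZ => ?_⟩
    have hZ1 := hZfst Zf hZ
    have hZK : ∀ n, Zf n ∈ Kb A B := fun n => (hKb _).mp (hZ n).1
    rw [hset, ← Submodule.topologicalClosure_coe]
    refine congrArg (fun V : Submodule ℂ HbP => (V : Set HbP)) (le_antisymm ?_ ?_)
    · refine Submodule.topologicalClosure_minimal _ ?_ (Submodule.isClosed_orthogonal _)
      rw [Submodule.span_le]
      rintro _ ⟨n, rfl⟩
      exact hZK n
    · have hle : (Submodule.span ℂ (Set.range Zf)).topologicalClosure ≤ Kb A B := by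
        refine Submodule.topologicalClosure_minimal _ ?_ (Submodule.isClosed_orthogonal _)
        rw [Submodule.span_le]
        rintro _ ⟨n, rfl⟩
        exact hZK n
      intro q hq
      haveI : CompleteSpace (Submodule.span ℂ (Set.range Zf)).topologicalClosure :=
        (Submodule.isClosed_topologicalClosure _).completeSpace_coe
      obtain ⟨y, hy, z, hz, rfl⟩ :=
        (Submodule.span ℂ (Set.range Zf)).topologicalClosure.exists_add_mem_mem_orthogonal q
      have hzK : z ∈ Kb A B := by
        have := (Kb A B).sub_mem hq (hle hy)
        rwa [add_sub_cancel_left] at this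
      have hz0 : z = 0 := ortho_zero (BF_mem hA) hCA hCB hpy hZK hZ1 hzK fun n =>
        (Submodule.mem_orthogonal _ _).mp hz _
          (Submodule.le_topologicalClosure _ (Submodule.subset_span ⟨n, rfl⟩))
      rw [hz0, add_zero]; exact hy

end
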